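/- Calderón's duality theorem: Let (X₀,X₁) be a regular Banach couple and θ ∈ (0,1). Then the dual space ([X₀,X₁]_θ)^# coincides isometrically with the upper interpolation space [X₀^#,X₁^#]^θ: y ∈ (X₀∩X₁)* satisfies sup{|⟨x,y⟩| : x ∈ X₀∩X₁, ‖x‖_{[X₀,X₁]_θ} ≤ 1} < ∞ if and only if y ∈ [X₀^#,X₁^#]^θ, and then the two norms are equal. -/

import Mathlib

open Complex Set
open scoped Real

/-- The open unit strip. -/
def Sopen : Set ℂ := {z : ℂ | 0 < z.re ∧ z.re < 1}

variable {X0 X1 E : Type*}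
  [NormedAddCommGroup X0] [NormedSpace ℂ X0]
  [NormedAddCommGroup X1] [NormedSpace ℂ X1]
  [NormedAddCommGroup E] [NormedSpace ℂ E]

/-- The disk version `F_𝔻(X₀, X₁)` of Calderón's function space (for the parameter `θ`):
`f : 𝔻 → X₀ + X₁` continuous on the closed disk, analytic in its interior, vanishing at
`1` and `e^{2πθi}`, whose restriction to the closed arc `Γ̄ⱼ` is a continuous `Xⱼ`-valued
function (`Γ̄₀` parametrized by `t ∈ [2πθ, 2π]`, `Γ̄₁` by `t ∈ [0, 2πθ]`).  The Banach
couple `(X₀, X₁)` is given by continuous injections `i0, i1` into the space `E` playing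
the role of `X₀ + X₁`. -/
structure CalderonDiskFun (θ : ℝ) (i0 : X0 →L[ℂ] E) (i1 : X1 →L[ℂ] E) where
  toFun : ℂ → E
  g0 : ℝ → X0
  g1 : ℝ → X1
  cont : ContinuousOn toFun (Metric.closedBall (0:ℂ) 1)
  anal : DifferentiableOn ℂ toFun (Metric.ball (0:ℂ) 1)
  vanish_one : toFun 1 = 0
  vanish_theta : toFun (Complex.exp ((2 * π * θ : ℝ) * I)) = 0
  cont_g0 : ContinuousOn g0 (Icc (2 * π * θ) (2 * π))
  cont_g1 : ContinuousOn g1 (Icc 0 (2 * π * θ))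
  eq_g0 : ∀ t ∈ Icc (2 * π * θ) (2 * π), i0 (g0 t) = toFun (Complex.exp ((t:ℝ) * I))
  eq_g1 : ∀ t ∈ Icc (0:ℝ) (2 * π * θ), i1 (g1 t) = toFun (Complex.exp ((t:ℝ) * I))

/-- The norm `‖f‖_{F_𝔻} = max (sup_{Γ₀} ‖f‖_{X₀}, sup_{Γ₁} ‖f‖_{X₁})`. -/
noncomputable def CalderonDiskFun.norm {θ : ℝ} {i0 : X0 →L[ℂ] E} {i1 : X1 →L[ℂ] E}
    (f : CalderonDiskFun θ i0 i1) : ℝ :=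
  max (sSup ((fun t => ‖f.g0 t‖) '' Icc (2 * π * θ) (2 * π)))
    (sSup ((fun t => ‖f.g1 t‖) '' Icc 0 (2 * π * θ)))

/-- The norm of Calderón's complex interpolation space `[X₀, X₁]_θ` (disk description):
`‖x‖_θ = inf {‖f‖_{F_𝔻} : f ∈ F_𝔻(X₀,X₁), f(0) = x}`. -/
noncomputable def interpNorm (θ : ℝ) (i0 : X0 →L[ℂ] E) (i1 : X1 →L[ℂ] E) (x : E) : ℝ :=
  sInf {r | ∃ f : CalderonDiskFun θ i0 i1, f.toFun 0 = x ∧ r = f.norm}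

/-- The intersection `X₀ ∩ X₁`, realized as the submodule of `X₀ × X₁` of pairs that
agree in `X₀ + X₁`. -/
def interSub (i0 : X0 →L[ℂ] E) (i1 : X1 →L[ℂ] E) : Submodule ℂ (X0 × X1) where
  carrier := {p | i0 p.1 = i1 p.2}
  add_mem' := by
    intro a b ha hb
    simp only [Set.mem_setOf_eq] at *
    simp [map_add, ha, hb]
  zero_mem' := by simp
  smul_mem' := by
    intro c a ha
    simp only [Set.mem_setOf_eq] at *
    simp [map_smul, ha]

/-- The restriction of the norm of `X₀` to `X₀ ∩ X₁`. -/
noncomputable def nzero (i0 : X0 →L[ℂ] E) (i1 : X1 →L[ℂ] E) (p : interSub i0 i1) : ℝ :=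
  ‖(p : X0 × X1).1‖

/-- The restriction of the norm of `X₁` to `X₀ ∩ X₁`. -/
noncomputable def none' (i0 : X0 →L[ℂ] E) (i1 : X1 →L[ℂ] E) (p : interSub i0 i1) : ℝ :=
  ‖(p : X0 × X1).2‖

/-- Membership in the space `ℋ(X₀^#, X₁^#)` (realized via linear functionals on
`X₀ ∩ X₁`): `h : S° → X₀^# + X₁^# = (X₀ ∩ X₁)^#` with `z ↦ ⟨b, h(z)⟩ ∈ H^∞(S°)` for each
`b ∈ X₀ ∩ X₁` and `|⟨b, h(z)⟩| ≤ C ‖b‖_{X₀}^{1−Re z} ‖b‖_{X₁}^{Re z}`. -/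
def MemH (i0 : X0 →L[ℂ] E) (i1 : X1 →L[ℂ] E)
    (h : ℂ → (interSub i0 i1 →ₗ[ℂ] ℂ)) : Prop :=
  (∀ z ∈ Sopen, ∃ C : ℝ, ∀ b : interSub i0 i1,
    ‖h z b‖ ≤ C * max (nzero i0 i1 b) (none' i0 i1 b)) ∧
  (∀ b : interSub i0 i1, DifferentiableOn ℂ (fun z => h z b) Sopen ∧
    ∃ B : ℝ, ∀ z ∈ Sopen, ‖h z b‖ ≤ B) ∧
  (∃ C : ℝ, ∀ b : interSub i0 i1, ∀ z ∈ Sopen,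
    ‖h z b‖ ≤ C * nzero i0 i1 b ^ (1 - z.re) * none' i0 i1 b ^ z.re)

/-- The norm `‖h‖_{ℋ(X₀^#, X₁^#)} = inf C` over admissible constants `C`. -/
noncomputable def HNorm (i0 : X0 →L[ℂ] E) (i1 : X1 →L[ℂ] E)
    (h : ℂ → (interSub i0 i1 →ₗ[ℂ] ℂ)) : ℝ :=
  sInf {C | 0 ≤ C ∧ ∀ b : interSub i0 i1, ∀ z ∈ Sopen,
    ‖h z b‖ ≤ C * nzero i0 i1 b ^ (1 - z.re) * none' i0 i1 b ^ z.re}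

/-- `‖y‖_{[X₀^#,X₁^#]^θ} = inf {‖h‖_ℋ : h ∈ ℋ(X₀^#,X₁^#), h(θ) = y}`. -/
noncomputable def upperNorm (θ : ℝ) (i0 : X0 →L[ℂ] E) (i1 : X1 →L[ℂ] E)
    (y : interSub i0 i1 →ₗ[ℂ] ℂ) : ℝ :=
  sInf {r | ∃ h, MemH i0 i1 h ∧ h ((θ:ℝ) : ℂ) = y ∧ r = HNorm i0 i1 h}

/-- `‖y‖_{([X₀,X₁]_θ)^#} = sup {|⟨x,y⟩| : x ∈ X₀ ∩ X₁, ‖x‖_{[X₀,X₁]_θ} ≤ 1}`. -/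
noncomputable def interpDualNorm (θ : ℝ) (i0 : X0 →L[ℂ] E) (i1 : X1 →L[ℂ] E)
    (y : interSub i0 i1 →ₗ[ℂ] ℂ) : ℝ :=
  sSup {r | ∃ p : interSub i0 i1,
    interpNorm θ i0 i1 (i0 (p : X0 × X1).1) ≤ 1 ∧ r = ‖y p‖}

section

open Filter Topology MeasureTheory

variable {X : Type*} [NormedAddCommGroup X] [NormedSpace ℂ X]

theorem norm_le_interp_of_tendsto {u : ℂ → ℂ} (hd : DifferentiableOn ℂ u Sopen)
    {B : ℝ} (hB : ∀ z ∈ Sopen, ‖u z‖ ≤ B) {α β : ℝ → ℝ} {a b : ℝ}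
    (hα : ∀ z ∈ Sopen, ‖u z‖ ≤ α z.re) (hβ : ∀ z ∈ Sopen, ‖u z‖ ≤ β z.re)
    (hαa : Tendsto α (𝓝[>] 0) (𝓝 a)) (hβb : Tendsto β (𝓝[<] 1) (𝓝 b))
    {z : ℂ} (hz : z ∈ Sopen) : ‖u z‖ ≤ a ^ (1 - z.re) * b ^ z.re := by
  obtain ⟨hz0, hz1⟩ := hz
  have hl : Tendsto (fun l : ℝ => l) (𝓝[>] 0) (𝓝 0) := tendsto_id.mono_left nhdsWithin_le_nhds
  have hexp : Tendsto (fun l : ℝ => (z.re - l) / ((1 - l) - l)) (𝓝[>] 0) (𝓝 z.re) := by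
    have : Tendsto (fun l : ℝ => (z.re - l) / ((1 - l) - l)) (𝓝[>] 0)
        (𝓝 ((z.re - 0) / ((1 - 0) - 0))) :=
      (tendsto_const_nhds.sub hl).div ((tendsto_const_nhds.sub hl).sub hl) (by norm_num)
    simpa using this
  have hβ' : Tendsto (fun l : ℝ => β (1 - l)) (𝓝[>] 0) (𝓝 b) := by
    refine hβb.comp (tendsto_nhdsWithin_iff.2 ⟨?_, ?_⟩)
    · simpa using tendsto_const_nhds.sub hl (a := (1 : ℝ))
    · filter_upwards [self_mem_nhdsWithin] with l hl
      simpa using hl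
  have hlim : Tendsto (fun l : ℝ => α l ^ (1 - (z.re - l) / ((1 - l) - l)) *
      β (1 - l) ^ ((z.re - l) / ((1 - l) - l))) (𝓝[>] 0) (𝓝 (a ^ (1 - z.re) * b ^ z.re)) :=
    (hαa.rpow (tendsto_const_nhds.sub hexp) (Or.inr (by linarith))).mul
      (hβ'.rpow hexp (Or.inr hz0))
  refine ge_of_tendsto hlim ?_
  have hsmall : ∀ᶠ l : ℝ in 𝓝[>] 0, l < min z.re (1 - z.re) :=
    nhdsWithin_le_nhds (Iio_mem_nhds (by simp [hz0, hz1]))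
  filter_upwards [hsmall, self_mem_nhdsWithin] with l hlm hl0
  rw [mem_Ioi] at hl0
  have h1 := hlm.trans_le (min_le_left _ _)
  have h2 := hlm.trans_le (min_le_right _ _)
  have hsub : ∀ w : ℂ, w.re ∈ Icc l (1 - l) → w ∈ Sopen := fun w hw =>
    ⟨by linarith [hw.1], by linarith [hw.2]⟩
  refine HadamardThreeLines.norm_le_interp_of_mem_verticalClosedStrip' (f := u) (by linarith)
    ⟨by linarith, by linarith⟩ ?_ ?_ ?_ ?_
  · apply DifferentiableOn.diffContOnCl
    refine hd.mono fun w hw => hsub w ?_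
    exact closure_minimal (t := re ⁻¹' Icc l (1 - l)) (preimage_mono Ioo_subset_Icc_self)
      (isClosed_Icc.preimage continuous_re) hw
  · refine ⟨B, ?_⟩
    rintro _ ⟨w, hw, rfl⟩
    exact hB w (hsub w hw)
  · rintro w hw
    have hw' : w.re = l := hw
    simpa [hw'] using hα w (hsub w (by rw [hw']; constructor <;> linarith))
  · rintro w hw
    have hw' : w.re = 1 - l := hw
    simpa [hw'] using hβ w (hsub w (by rw [hw']; constructor <;> linarith))

/-- The entire Gaussian kernel `√(ν/π) exp(ν ζ²)`, an approximate identity on vertical lines. -/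
noncomputable def gaussKernel (ν : ℝ) (ζ : ℂ) : ℂ := (√(ν / π) : ℝ) * cexp (ν * ζ ^ 2)

theorem differentiable_gaussKernel (ν : ℝ) : Differentiable ℂ (gaussKernel ν) := by
  unfold gaussKernel
  fun_prop

theorem norm_gaussKernel (ν : ℝ) (ζ : ℂ) :
    ‖gaussKernel ν ζ‖ = Real.exp (ν * ζ.re ^ 2) * (√(ν / π) * Real.exp (-ν * ζ.im ^ 2)) := by
  have : ((ν : ℂ) * ζ ^ 2).re = ν * ζ.re ^ 2 + -ν * ζ.im ^ 2 := by
    simp [sq]; ring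
  rw [gaussKernel, norm_mul, norm_exp, this, Real.exp_add, norm_real,
    Real.norm_of_nonneg (Real.sqrt_nonneg _)]
  ring

theorem integral_gaussKernel {ν : ℝ} (hν : 0 < ν) (c : ℝ) (z : ℂ) :
    ∫ s : ℝ, gaussKernel ν (c + s * I - z) = 1 := by
  have h1 : ∀ s : ℝ, gaussKernel ν (c + s * I - z) =
      (fun v : ℝ => (√(ν / π) : ℝ) * cexp (-(ν : ℂ) * (v + ((z.re - c : ℝ) : ℂ) * I) ^ 2))
        (s - z.im) := by
    intro s
    simp only [gaussKernel]
    congr 2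
    have : (c + s * I - z : ℂ) = I * ((s - z.im : ℝ) + ((z.re - c : ℝ) : ℂ) * I) := by
      apply Complex.ext <;> simp
    rw [this, mul_pow, I_sq]
    ring
  simp_rw [h1]
  rw [integral_sub_right_eq_self
    (fun v : ℝ => ((√(ν / π) : ℝ) : ℂ) * cexp (-(ν : ℂ) * (v + ((z.re - c : ℝ) : ℂ) * I) ^ 2)) z.im,
    integral_const_mul, GaussianFourier.integral_cexp_neg_mul_sq_add_real_mul_I (by simpa using hν)]
  have h2 : ((π : ℂ) / ν) ^ (1 / 2 : ℂ) = (√(π / ν) : ℝ) := by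
    rw [Real.sqrt_eq_rpow, ofReal_cpow (by positivity)]
    push_cast
    rfl
  rw [h2, ← ofReal_mul, ← Real.sqrt_mul (by positivity),
    div_mul_div_cancel₀ Real.pi_ne_zero, div_self hν.ne']
  simp

theorem integrable_abs_mul_exp_neg_mul_sq {ν : ℝ} (hν : 0 < ν) :
    Integrable fun v : ℝ => |v| * Real.exp (-ν * v ^ 2) := by
  refine (integrable_mul_exp_neg_mul_sq hν).norm.congr (.of_forall fun v => ?_)
  simp

theorem integral_abs_mul_exp_neg_mul_sq {ν : ℝ} (hν : 0 < ν) :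
    ∫ v : ℝ, |v| * Real.exp (-ν * v ^ 2) = ν⁻¹ := by
  have h := integral_comp_abs (f := fun v : ℝ => v * Real.exp (-ν * v ^ 2))
  simp only [sq_abs] at h
  rw [h]
  have h2 := integral_mul_cexp_neg_mul_sq (b := (ν : ℂ)) (by simpa using hν)
  have h3 : ∀ r : ℝ, (r : ℂ) * cexp (-ν * r ^ 2) = ((r * Real.exp (-ν * r ^ 2) : ℝ) : ℂ) := by
    intro r; push_cast; rfl
  simp_rw [h3] at h2
  rw [integral_complex_ofReal] at h2
  have h4 : ∫ r : ℝ in Ioi 0, r * Real.exp (-ν * r ^ 2) = (2 * ν)⁻¹ := by exact_mod_cast h2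
  rw [h4]
  field_simp

theorem integrable_gaussKernel {ν : ℝ} (hν : 0 < ν) (c : ℝ) (z : ℂ) :
    Integrable fun s : ℝ => gaussKernel ν (c + s * I - z) := by
  by_contra h
  have := integral_gaussKernel hν c z
  rw [integral_undef h] at this
  exact zero_ne_one this

theorem integrable_gaussKernel_smul {ν : ℝ} (hν : 0 < ν) (c : ℝ) (z : ℂ) {G : ℝ → X}
    (hG : Continuous G) {B : ℝ} (hB : ∀ s, ‖G s‖ ≤ B) :
    Integrable fun s : ℝ => gaussKernel ν (c + s * I - z) • G s :=
  (integrable_gaussKernel hν c z).smul_bdd B hG.aestronglyMeasurable (.of_forall hB)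

/-- The Gaussian regularization of a function `G` on the line `Re = c`. -/
noncomputable def gaussMollify (ν c : ℝ) (G : ℝ → X) (z : ℂ) : X :=
  ∫ s : ℝ, gaussKernel ν (c + s * I - z) • G s

theorem norm_integral_gaussKernel_smul_le {ν : ℝ} (hν : 0 < ν) (c : ℝ) (z : ℂ) {H : ℝ → X}
    {R L : ℝ} (hL : 0 ≤ L) (hH : ∀ s : ℝ, ‖H s‖ ≤ R + L * ‖(c + s * I - z : ℂ)‖) :
    ‖∫ s : ℝ, gaussKernel ν (c + s * I - z) • H s‖ ≤
      Real.exp (ν * (c - z.re) ^ 2) * (R + L * |c - z.re| + L * (√(ν / π) * ν⁻¹)) := by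
  set e := Real.exp (ν * (c - z.re) ^ 2)
  set q := √(ν / π)
  set g : ℝ → ℝ := fun v => e * ((R + L * |c - z.re|) * (q * Real.exp (-ν * v ^ 2)) +
    L * (q * (|v| * Real.exp (-ν * v ^ 2)))) with hg
  have hi1 := (integrable_exp_neg_mul_sq hν).const_mul q |>.const_mul (R + L * |c - z.re|)
  have hi2 := ((integrable_abs_mul_exp_neg_mul_sq hν).const_mul q).const_mul L
  have hgi : Integrable g := (hi1.add hi2).const_mul e
  have hgint : ∫ v, g v = e * (R + L * |c - z.re| + L * (q * ν⁻¹)) := by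
    rw [hg, integral_const_mul, integral_add hi1 hi2]
    simp only [integral_const_mul]
    rw [integral_gaussian, integral_abs_mul_exp_neg_mul_sq hν]
    have : q * √(π / ν) = 1 := by
      rw [← Real.sqrt_mul (by positivity), div_mul_div_cancel₀ Real.pi_ne_zero, div_self hν.ne',
        Real.sqrt_one]
    rw [this, mul_one]
  rw [← hgint, ← integral_sub_right_eq_self g z.im]
  refine norm_integral_le_of_norm_le (hgi.comp_sub_right z.im) (.of_forall fun s => ?_)
  have hre : (c + s * I - z : ℂ).re = c - z.re := by simp
  have him : (c + s * I - z : ℂ).im = s - z.im := by simp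
  have hn : ‖(c + s * I - z : ℂ)‖ ≤ |c - z.re| + |s - z.im| := by
    have := norm_le_abs_re_add_abs_im (c + s * I - z : ℂ)
    rwa [hre, him] at this
  rw [norm_smul, norm_gaussKernel, hre, him]
  calc _ ≤ e * (q * Real.exp (-ν * (s - z.im) ^ 2)) * (R + L * (|c - z.re| + |s - z.im|)) := by
        gcongr
        exact (hH s).trans (by gcongr)
    _ = g (s - z.im) := by simp only [hg]; ring

theorem hasDerivAt_gaussKernel (ν : ℝ) (ζ : ℂ) :
    HasDerivAt (gaussKernel ν) (2 * ν * ζ * gaussKernel ν ζ) ζ := by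
  have h : HasDerivAt (fun ζ : ℂ => (ν : ℂ) * ζ ^ 2) (ν * (2 * ζ)) ζ := by
    simpa using (hasDerivAt_pow 2 ζ).const_mul (ν : ℂ)
  refine (h.cexp.const_mul ((√(ν / π) : ℝ) : ℂ)).congr_deriv ?_
  simp only [gaussKernel]
  ring

theorem differentiable_gaussMollify {ν : ℝ} (hν : 0 < ν) (c : ℝ) {G : ℝ → X}
    (hG : Continuous G) {B : ℝ} (hB : ∀ s, ‖G s‖ ≤ B) :
    Differentiable ℂ (gaussMollify ν c G) := by
  intro z
  have hk := (differentiable_gaussKernel ν).continuous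
  have hν2 : 0 < ν / 2 := by positivity
  set r := |c - z.re| + 1
  set K := 2 * ν * (Real.exp (ν * r ^ 2 + ν) * √(ν / π)) * B
  have hB0 : 0 ≤ B := (norm_nonneg _).trans (hB 0)
  set bound : ℝ → ℝ := fun v => K * ((r + 1) * Real.exp (-(ν / 2) * v ^ 2) +
    |v| * Real.exp (-(ν / 2) * v ^ 2)) with hbound
  have hbi : Integrable bound :=
    (((integrable_exp_neg_mul_sq hν2).const_mul _).add
      (integrable_abs_mul_exp_neg_mul_sq hν2)).const_mul K
  refine (hasDerivAt_integral_of_dominated_loc_of_deriv_le (s := Metric.ball z 1)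
    (bound := fun s => bound (s - z.im))
    (F := fun w s => gaussKernel ν (c + s * I - w) • G s)
    (F' := fun w s => (-(2 * ν * (c + s * I - w) * gaussKernel ν (c + s * I - w))) • G s)
    (Metric.ball_mem_nhds z one_pos)
    ?_ (integrable_gaussKernel_smul hν c z hG hB) ?_ ?_ (hbi.comp_sub_right z.im) ?_).2.differentiableAt
  · exact .of_forall fun w =>
      (integrable_gaussKernel_smul hν c w hG hB).aestronglyMeasurable
  · refine Continuous.aestronglyMeasurable ?_
    fun_prop
  · refine .of_forall fun s w hw => ?_
    have hw' : ‖w - z‖ < 1 := by simpa [dist_eq_norm] using hw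
    have hwr : |w.re - z.re| ≤ 1 := by
      simpa using (abs_re_le_norm (w - z)).trans hw'.le
    have hwi : |w.im - z.im| ≤ 1 := by
      simpa using (abs_im_le_norm (w - z)).trans hw'.le
    have hre : (c + s * I - w : ℂ).re = c - w.re := by simp
    have him : (c + s * I - w : ℂ).im = s - w.im := by simp
    have h1 : |c - w.re| ≤ r := by
      have := abs_sub_le c z.re w.re
      rw [abs_sub_comm z.re] at this
      simp only [r]; linarith
    have h2 : |s - w.im| ≤ |s - z.im| + 1 := by
      have := abs_sub_le s z.im w.im
      rw [abs_sub_comm z.im] at this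
      linarith
    have h3 : (c - w.re) ^ 2 ≤ r ^ 2 := sq_le_sq' (abs_le.1 h1).1 (abs_le.1 h1).2
    have h4 : (s - z.im) ^ 2 / 2 ≤ (s - w.im) ^ 2 + 1 := by
      have : (w.im - z.im) ^ 2 ≤ 1 := by
        have := sq_le_sq' (abs_le.1 hwi).1 (abs_le.1 hwi).2
        simpa using this
      nlinarith [sq_nonneg ((s - w.im) - (w.im - z.im))]
    have hn : ‖(c + s * I - w : ℂ)‖ ≤ r + 1 + |s - z.im| := by
      have := norm_le_abs_re_add_abs_im (c + s * I - w : ℂ)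
      rw [hre, him] at this
      linarith
    have hkn : ‖gaussKernel ν (c + s * I - w)‖ ≤
        Real.exp (ν * r ^ 2 + ν) * √(ν / π) * Real.exp (-(ν / 2) * (s - z.im) ^ 2) := by
      rw [norm_gaussKernel, hre, him]
      have : Real.exp (ν * (c - w.re) ^ 2) * Real.exp (-ν * (s - w.im) ^ 2) ≤
          Real.exp (ν * r ^ 2 + ν) * Real.exp (-(ν / 2) * (s - z.im) ^ 2) := by
        rw [← Real.exp_add, ← Real.exp_add, Real.exp_le_exp]
        nlinarith
      calc _ = √(ν / π) * (Real.exp (ν * (c - w.re) ^ 2) * Real.exp (-ν * (s - w.im) ^ 2)) := by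
            ring
        _ ≤ √(ν / π) * (Real.exp (ν * r ^ 2 + ν) * Real.exp (-(ν / 2) * (s - z.im) ^ 2)) := by
            gcongr
        _ = _ := by ring
    rw [norm_smul, norm_neg, norm_mul, norm_mul, norm_mul, norm_real, Real.norm_of_nonneg hν.le,
      Complex.norm_ofNat]
    calc _ ≤ 2 * ν * (r + 1 + |s - z.im|) * (Real.exp (ν * r ^ 2 + ν) * √(ν / π) *
          Real.exp (-(ν / 2) * (s - z.im) ^ 2)) * B := by
          gcongr
          exact hB s
      _ = bound (s - z.im) := by simp only [hbound, K]; ring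
  · refine .of_forall fun s w _ => ?_
    have h1 : HasDerivAt (fun w : ℂ => (c + s * I - w : ℂ)) (-1) w := by
      simpa using (hasDerivAt_id w).const_sub (c + s * I : ℂ)
    have h2 := ((hasDerivAt_gaussKernel ν (c + s * I - w)).comp w h1).smul_const (G s)
    refine h2.congr_deriv ?_
    rw [mul_neg_one]

theorem gaussMollify_zero_eq_one [CompleteSpace X] {ν : ℝ} (hν : 0 < ν) {g : ℂ → X}
    (hc : ContinuousOn g (re ⁻¹' Icc 0 1)) (hd : DifferentiableOn ℂ g Sopen)
    {B : ℝ} (hB : ∀ z ∈ re ⁻¹' Icc (0 : ℝ) 1, ‖g z‖ ≤ B) (z : ℂ) :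
    gaussMollify ν 0 (fun s => g ((0 : ℝ) + s * I)) z =
      gaussMollify ν 1 (fun s => g ((1 : ℝ) + s * I)) z := by
  set f : ℂ → X := fun ζ => gaussKernel ν (ζ - z) • g ζ with hf
  have hB0 : 0 ≤ B := (norm_nonneg _).trans (hB 0 (by simp))
  have hline : ∀ c ∈ Icc (0 : ℝ) 1, Continuous fun s : ℝ => g (c + s * I) := by
    intro c hcm
    refine hc.comp_continuous (by fun_prop) fun s => ?_
    simpa using hcm
  have hintegr : ∀ c ∈ Icc (0 : ℝ) 1, Integrable fun s : ℝ => f (c + s * I) := fun c hcm =>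
    integrable_gaussKernel_smul hν c z (hline c hcm) (B := B) fun s => hB _ (by simpa using hcm)
  have hlim : ∀ c ∈ Icc (0 : ℝ) 1, Tendsto (fun T : ℝ => ∫ s in (-T)..T, f (c + s * I)) atTop
      (𝓝 (∫ s : ℝ, f (c + s * I))) := fun c hcm =>
    intervalIntegral_tendsto_integral (hintegr c hcm) tendsto_neg_atTop_atBot tendsto_id
  have hfc : ContinuousOn f (re ⁻¹' Icc 0 1) := by
    refine ContinuousOn.smul ?_ hc
    exact ((differentiable_gaussKernel ν).continuous.comp (continuous_id.sub continuous_const)).continuousOn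
  have hfd : DifferentiableOn ℂ f Sopen := by
    refine DifferentiableOn.smul ?_ hd
    exact ((differentiable_gaussKernel ν).comp (differentiable_id.sub_const z)).differentiableOn
  set r := |z.re| + 1
  have hhor : ∀ ε : ℝ, ε = 1 ∨ ε = -1 →
      Tendsto (fun T : ℝ => ∫ x in (0 : ℝ)..1, f (x + ((ε * T : ℝ) : ℂ) * I)) atTop (𝓝 0) := by
    intro ε hε
    have hb : ∀ T : ℝ, ‖∫ x in (0 : ℝ)..1, f (x + ((ε * T : ℝ) : ℂ) * I)‖ ≤
        Real.exp (ν * r ^ 2) * (√(ν / π) * Real.exp (-ν * (ε * T - z.im) ^ 2)) * B := by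
      intro T
      refine (intervalIntegral.norm_integral_le_of_norm_le_const (C := Real.exp (ν * r ^ 2) *
        (√(ν / π) * Real.exp (-ν * (ε * T - z.im) ^ 2)) * B) fun x hx => ?_).trans (by simp)
      rw [uIoc_of_le zero_le_one] at hx
      have hre : (x + ((ε * T : ℝ) : ℂ) * I - z : ℂ).re = x - z.re := by simp
      have him : (x + ((ε * T : ℝ) : ℂ) * I - z : ℂ).im = ε * T - z.im := by simp
      simp only [hf]
      rw [norm_smul, norm_gaussKernel, hre, him]
      have hx1 : |x - z.re| ≤ r := by
        have := abs_sub x z.re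
        rw [abs_of_pos hx.1] at this
        simp only [r]; linarith [hx.2]
      have : (x - z.re) ^ 2 ≤ r ^ 2 := sq_le_sq' (abs_le.1 hx1).1 (abs_le.1 hx1).2
      gcongr
      exact hB _ (by simpa using ⟨hx.1.le, hx.2⟩)
    refine squeeze_zero_norm hb ?_
    have h1 : Tendsto (fun T : ℝ => -ν * (ε * T - z.im) ^ 2) atTop atBot := by
      have h2 : Tendsto (fun T : ℝ => (ε * T - z.im) ^ 2) atTop atTop := by
        have h3 : (fun T : ℝ => (ε * T - z.im) ^ 2) = fun T => (T + -(ε * z.im)) ^ 2 := by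
          funext T
          rcases hε with rfl | rfl <;> ring
        rw [h3]
        exact (tendsto_pow_atTop two_ne_zero).comp (tendsto_atTop_add_const_right _ _ tendsto_id)
      exact h2.const_mul_atTop_of_neg (by linarith)
    simpa using (((Real.tendsto_exp_atBot.comp h1).const_mul (√(ν / π))).const_mul
      (Real.exp (ν * r ^ 2))).mul_const B
  have hrect : ∀ᶠ T : ℝ in atTop, (((∫ x in (0 : ℝ)..1, f (x + ((-1 * T : ℝ) : ℂ) * I)) -
      ∫ x in (0 : ℝ)..1, f (x + ((1 * T : ℝ) : ℂ) * I)) +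
      I • ∫ s in (-T)..T, f ((1 : ℝ) + s * I)) - I • ∫ s in (-T)..T, f ((0 : ℝ) + s * I) = 0 := by
    filter_upwards [eventually_gt_atTop 0] with T hT
    have := integral_boundary_rect_eq_zero_of_continuousOn_of_differentiableOn f
      (⟨0, -T⟩ : ℂ) (⟨1, T⟩ : ℂ) (hfc.mono ?_) (hfd.mono ?_)
    · simpa using this
    · intro w hw
      rw [mem_reProdIm] at hw
      simpa using hw.1
    · intro w hw
      rw [mem_reProdIm] at hw
      simpa [Sopen] using hw.1
  have hfinal := (((hhor (-1) (Or.inr rfl)).sub (hhor 1 (Or.inl rfl))).add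
    ((hlim 1 (by simp)).const_smul I)).sub ((hlim 0 (by simp)).const_smul I)
  have h0 := tendsto_nhds_unique (hfinal.congr' hrect) tendsto_const_nhds
  rw [sub_zero, zero_add, sub_eq_zero] at h0
  exact (smul_right_injective X I_ne_zero h0).symm

theorem norm_smul_add_smul_gaussMollify_le [CompleteSpace X] {ν : ℝ} (hν : 0 < ν) (c : ℝ) (z : ℂ)
    {G : ℝ → X} (hG : Continuous G) {B : ℝ} (hB : ∀ s, ‖G s‖ ≤ B) {φ ψ : ℂ → ℂ} {L R : ℝ}
    (hL : 0 ≤ L) (hφL : ∀ s : ℝ, ‖φ z - φ (c + s * I)‖ ≤ L * ‖(c + s * I - z : ℂ)‖)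
    (hψL : ∀ s : ℝ, ‖ψ z - ψ (c + s * I)‖ ≤ L * ‖(c + s * I - z : ℂ)‖) (x : X)
    (hR : ∀ s : ℝ, ‖φ (c + s * I) • x + ψ (c + s * I) • G s‖ ≤ R) :
    ‖φ z • x + ψ z • gaussMollify ν c G z‖ ≤ Real.exp (ν * (c - z.re) ^ 2) *
      (R + L * (‖x‖ + B) * |c - z.re| + L * (‖x‖ + B) * (√(ν / π) * ν⁻¹)) := by
  have hB0 : 0 ≤ B := (norm_nonneg _).trans (hB 0)
  have hrep : φ z • x + ψ z • gaussMollify ν c G z =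
      ∫ s : ℝ, gaussKernel ν (c + s * I - z) • (φ z • x + ψ z • G s) := by
    simp_rw [smul_add, smul_comm _ (ψ z)]
    rw [integral_add (g := fun s : ℝ => ψ z • gaussKernel ν (c + s * I - z) • G s)
      ((integrable_gaussKernel hν c z).smul_const _)
      ((integrable_gaussKernel_smul hν c z hG hB).smul (ψ z)), integral_smul_const,
      integral_gaussKernel hν, one_smul, integral_smul, gaussMollify]
  rw [hrep]
  refine norm_integral_gaussKernel_smul_le hν c z (by positivity) fun s => ?_
  have : φ z • x + ψ z • G s = (φ (c + s * I) • x + ψ (c + s * I) • G s) +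
      ((φ z - φ (c + s * I)) • x + (ψ z - ψ (c + s * I)) • G s) := by
    module
  rw [this]
  refine (norm_add_le _ _).trans (add_le_add (hR s) ((norm_add_le _ _).trans ?_))
  rw [norm_smul, norm_smul]
  have h1 := mul_le_mul_of_nonneg_right (hφL s) (norm_nonneg x)
  have h2 := mul_le_mul (hψL s) (hB s) (norm_nonneg _) (by positivity)
  linarith

theorem differentiableAt_apply_of_norm_le {h : ℂ → (X →ₗ[ℂ] ℂ)} {U : Set ℂ} (hU : IsOpen U) {C : ℝ}
    (hC : ∀ z ∈ U, ∀ b, ‖h z b‖ ≤ C * ‖b‖) (hd : ∀ b, DifferentiableOn ℂ (fun z => h z b) U)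
    {k : ℂ → X} {z : ℂ} (hz : z ∈ U) (hk : DifferentiableAt ℂ k z) :
    DifferentiableAt ℂ (fun w => h w (k w)) z := by
  have hUz := hU.mem_nhds hz
  have hdz : ∀ b, HasDerivAt (fun w => h w b) (deriv (fun w => h w b) z) z := fun b =>
    ((hd b).differentiableAt hUz).hasDerivAt
  have h1 := hasDerivAt_iff_tendsto_slope.1 (hdz (k z))
  have h2 := hasDerivAt_iff_tendsto_slope.1 hk.hasDerivAt
  set D := deriv k z
  have h3 : Tendsto (fun w => h w D) (𝓝[≠] z) (𝓝 (h z D)) :=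
    (hdz D).continuousAt.tendsto.mono_left nhdsWithin_le_nhds
  have h4 : Tendsto (fun w => h w (slope k z w - D)) (𝓝[≠] z) (𝓝 0) := by
    have h5 : Tendsto (fun w => C * ‖slope k z w - D‖) (𝓝[≠] z) (𝓝 0) := by
      simpa using ((h2.sub_const D).norm.const_mul C)
    refine squeeze_zero_norm' ?_ h5
    filter_upwards [nhdsWithin_le_nhds hUz] with w hw using hC w hw _
  refine HasDerivAt.differentiableAt (f' := 0 + h z D + _) (hasDerivAt_iff_tendsto_slope.2
    (((h4.add h3).add h1).congr fun w => ?_))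
  simp only [slope_def_module, map_sub, map_smul, smul_eq_mul]
  ring

theorem differentiableAt_codRestrict {k : ℂ → X} {S : Submodule ℂ X} (hS : IsClosed (S : Set X))
    (hmem : ∀ w, k w ∈ S) {z : ℂ} (hk : DifferentiableAt ℂ k z) :
    DifferentiableAt ℂ (fun w => (⟨k w, hmem w⟩ : S)) z := by
  have h := hasDerivAt_iff_tendsto_slope.1 hk.hasDerivAt
  have hslope : ∀ w, slope k z w ∈ S := fun w => by
    rw [slope_def_module]
    exact S.smul_mem _ (S.sub_mem (hmem w) (hmem z))
  have hD : deriv k z ∈ S := hS.mem_of_tendsto h (.of_forall hslope)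
  refine HasDerivAt.differentiableAt (f' := (⟨deriv k z, hD⟩ : S))
    (hasDerivAt_iff_tendsto_slope.2 ?_)
  rw [tendsto_subtype_rng]
  refine h.congr fun w => ?_
  simp [slope_def_module]

theorem isClosed_interSub (i0 : X0 →L[ℂ] E) (i1 : X1 →L[ℂ] E) :
    IsClosed (interSub i0 i1 : Set (X0 × X1)) :=
  isClosed_eq (i0.continuous.comp continuous_fst) (i1.continuous.comp continuous_snd)

theorem isOpen_Sopen : IsOpen Sopen :=
  (isOpen_lt continuous_const continuous_re).inter (isOpen_lt continuous_re continuous_const)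

theorem rpow_one_sub_mul_rpow_le {a b N x : ℝ} (ha : 0 ≤ a) (hb : 0 ≤ b) (haN : a ≤ N) (hbN : b ≤ N)
    (hx0 : 0 < x) (hx1 : x < 1) : a ^ (1 - x) * b ^ x ≤ N := by
  have hN : 0 ≤ N := ha.trans haN
  calc a ^ (1 - x) * b ^ x ≤ N ^ (1 - x) * N ^ x := by
        gcongr
    _ = N := by
        rw [← Real.rpow_add' hN (by norm_num)]
        norm_num

theorem norm_apply_le_of_strip [CompleteSpace X0] [CompleteSpace X1] [CompleteSpace E]
    {i0 : X0 →L[ℂ] E} {i1 : X1 →L[ℂ] E} {h : ℂ → (interSub i0 i1 →ₗ[ℂ] ℂ)} {C : ℝ} (hC : 0 ≤ C)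
    (hbound : ∀ b : interSub i0 i1, ∀ z ∈ Sopen,
      ‖h z b‖ ≤ C * nzero i0 i1 b ^ (1 - z.re) * none' i0 i1 b ^ z.re)
    (hdiff : ∀ b : interSub i0 i1, DifferentiableOn ℂ (fun z => h z b) Sopen)
    {g : ℂ → E} (hgc : ContinuousOn g (re ⁻¹' Icc 0 1)) (hgd : DifferentiableOn ℂ g Sopen)
    {B : ℝ} (hgB : ∀ z ∈ re ⁻¹' Icc (0 : ℝ) 1, ‖g z‖ ≤ B)
    {G0 : ℝ → X0} {G1 : ℝ → X1} (hG0 : Continuous G0) (hG1 : Continuous G1) {B0 B1 : ℝ}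
    (hB0 : ∀ s, ‖G0 s‖ ≤ B0) (hB1 : ∀ s, ‖G1 s‖ ≤ B1)
    (hi0 : ∀ s : ℝ, i0 (G0 s) = g ((0 : ℝ) + s * I))
    (hi1 : ∀ s : ℝ, i1 (G1 s) = g ((1 : ℝ) + s * I))
    {φ ψ : ℂ → ℂ} (hφ : DifferentiableOn ℂ φ Sopen) (hψ : DifferentiableOn ℂ ψ Sopen)
    {L : ℝ} (hL : 0 ≤ L)
    (hφL : ∀ z ∈ re ⁻¹' Icc (0 : ℝ) 1, ∀ w ∈ re ⁻¹' Icc (0 : ℝ) 1, ‖φ z - φ w‖ ≤ L * ‖w - z‖)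
    (hψL : ∀ z ∈ re ⁻¹' Icc (0 : ℝ) 1, ∀ w ∈ re ⁻¹' Icc (0 : ℝ) 1, ‖ψ z - ψ w‖ ≤ L * ‖w - z‖)
    (p : interSub i0 i1) {R : ℝ}
    (hR0 : ∀ s : ℝ, ‖φ ((0 : ℝ) + s * I) • (p : X0 × X1).1 + ψ ((0 : ℝ) + s * I) • G0 s‖ ≤ R)
    (hR1 : ∀ s : ℝ, ‖φ ((1 : ℝ) + s * I) • (p : X0 × X1).2 + ψ ((1 : ℝ) + s * I) • G1 s‖ ≤ R)
    {z₀ : ℂ} (hz₀ : z₀ ∈ Sopen) (hφz : φ z₀ = 1) (hψz : ψ z₀ = 0) :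
    ‖h z₀ p‖ ≤ C * R := by
  have hR : 0 ≤ R := (norm_nonneg _).trans (hR0 0)
  have hB00 : 0 ≤ B0 := (norm_nonneg _).trans (hB0 0)
  have hB10 : 0 ≤ B1 := (norm_nonneg _).trans (hB1 0)
  set Λ := L * (‖p‖ + B0 + B1) + 1 with hΛ
  have hΛpos : 0 < Λ := by positivity
  have hp0 : ‖(p : X0 × X1).1‖ ≤ ‖p‖ := le_max_left _ _
  have hp1 : ‖(p : X0 × X1).2‖ ≤ ‖p‖ := le_max_right _ _
  have key : ∀ ν : ℝ, 0 < ν → ‖h z₀ p‖ ≤ C * (R + Λ * (√(ν / π) * ν⁻¹)) := by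
    intro ν hν
    set κ := √(ν / π) * ν⁻¹
    have hκ : 0 < κ := by positivity
    have hmem : ∀ z, (gaussMollify ν 0 G0 z, gaussMollify ν 1 G1 z) ∈ interSub i0 i1 := by
      intro z
      change i0 (gaussMollify ν 0 G0 z) = i1 (gaussMollify ν 1 G1 z)
      have := gaussMollify_zero_eq_one hν hgc hgd hgB z
      simp_rw [← hi0, ← hi1, gaussMollify, ← map_smul] at this
      rw [gaussMollify, gaussMollify, ← i0.integral_comp_comm
        (integrable_gaussKernel_smul hν 0 z hG0 hB0), ← i1.integral_comp_comm
        (integrable_gaussKernel_smul hν 1 z hG1 hB1)]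
      exact this
    set k : ℂ → interSub i0 i1 := fun z => ⟨_, hmem z⟩
    have hk : ∀ z, DifferentiableAt ℂ k z := fun z =>
      differentiableAt_codRestrict (isClosed_interSub i0 i1) hmem
        ((differentiable_gaussMollify hν 0 hG0 hB0 z).prodMk
          (differentiable_gaussMollify hν 1 hG1 hB1 z))
    have hhC : ∀ z ∈ Sopen, ∀ b : interSub i0 i1, ‖h z b‖ ≤ C * ‖b‖ := by
      intro z hz b
      refine (hbound b z hz).trans ?_
      rw [mul_assoc]
      gcongr
      exact rpow_one_sub_mul_rpow_le (norm_nonneg _) (norm_nonneg _) (le_max_left _ _)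
        (le_max_right _ _) hz.1 hz.2
    set u : ℂ → ℂ := fun z => h z (φ z • p + ψ z • k z) with hu
    have hud : DifferentiableOn ℂ u Sopen := by
      have : u = fun z => φ z * h z p + ψ z * h z (k z) := by
        funext z
        simp [hu]
      rw [this]
      refine (hφ.mul (hdiff p)).add (hψ.mul fun z hz => ?_)
      exact (differentiableAt_apply_of_norm_le isOpen_Sopen hhC hdiff hz
        (hk z)).differentiableWithinAt
    set a : ℝ → ℝ := fun x => Real.exp (ν * x ^ 2) * (R + Λ * x + Λ * κ) with ha
    have hQ0 : ∀ z ∈ Sopen, nzero i0 i1 (φ z • p + ψ z • k z) ≤ a z.re := by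
      intro z hz
      have hzI : z ∈ re ⁻¹' Icc (0 : ℝ) 1 := ⟨hz.1.le, hz.2.le⟩
      have := norm_smul_add_smul_gaussMollify_le hν 0 z hG0 hB0 hL
        (fun s => hφL z hzI _ (by simp)) (fun s => hψL z hzI _ (by simp)) _ hR0
      refine this.trans ?_
      rw [zero_sub, neg_sq, abs_neg, abs_of_pos hz.1]
      have : L * (‖(p : X0 × X1).1‖ + B0) ≤ Λ := by
        rw [hΛ]
        nlinarith
      have := hz.1.le
      simp only [ha]
      gcongr
    have hQ1 : ∀ z ∈ Sopen, none' i0 i1 (φ z • p + ψ z • k z) ≤ a (1 - z.re) := by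
      intro z hz
      have hzI : z ∈ re ⁻¹' Icc (0 : ℝ) 1 := ⟨hz.1.le, hz.2.le⟩
      have := norm_smul_add_smul_gaussMollify_le hν 1 z hG1 hB1 hL
        (fun s => hφL z hzI _ (by simp)) (fun s => hψL z hzI _ (by simp)) _ hR1
      refine this.trans ?_
      have hz1 : 0 < 1 - z.re := sub_pos.2 hz.2
      rw [abs_of_pos hz1]
      have : L * (‖(p : X0 × X1).2‖ + B1) ≤ Λ := by
        rw [hΛ]
        nlinarith
      simp only [ha]
      gcongr
    set α : ℝ → ℝ := fun x => C * a x ^ (1 - x) * a (1 - x) ^ x with hα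
    have hapos : ∀ x, 0 ≤ x → 0 < a x := fun x hx => by
      simp only [ha]
      positivity
    have huα : ∀ z ∈ Sopen, ‖u z‖ ≤ α z.re := by
      intro z hz
      refine (hbound _ z hz).trans ?_
      have h1 : 0 ≤ 1 - z.re := by linarith [hz.2]
      have h2 : 0 ≤ z.re := hz.1.le
      have h3 := hapos _ h1
      have h4 := hapos _ h2
      have h5 : 0 ≤ nzero i0 i1 (φ z • p + ψ z • k z) := norm_nonneg _
      have h6 : 0 ≤ none' i0 i1 (φ z • p + ψ z • k z) := norm_nonneg _
      simp only [hα]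
      gcongr
      · exact hQ0 z hz
      · exact hQ1 z hz
    have ha1 : ∀ x, 0 ≤ x → x ≤ 1 → a x ≤ a 1 := by
      intro x hx hx1
      simp only [ha]
      have : x ^ 2 ≤ 1 ^ 2 := by gcongr
      gcongr
    have huB : ∀ z ∈ Sopen, ‖u z‖ ≤ C * a 1 := by
      intro z hz
      refine (huα z hz).trans ?_
      have h1 := hz.1
      have h2 := hz.2
      simp only [hα]
      rw [mul_assoc]
      gcongr
      exact rpow_one_sub_mul_rpow_le (hapos _ h1.le).le (hapos _ (by linarith)).le
        (ha1 _ h1.le h2.le) (ha1 _ (by linarith) (by linarith)) h1 h2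
    have hac : Continuous a := by fun_prop
    have ha0 : a 0 = R + Λ * κ := by simp [ha]
    have hlim0 : Tendsto α (𝓝[>] 0) (𝓝 (C * a 0)) := by
      have : ContinuousAt α 0 := by
        refine ContinuousAt.mul (continuousAt_const.mul ?_) ?_
        · exact hac.continuousAt.rpow (by fun_prop) (Or.inl (hapos 0 le_rfl).ne')
        · exact (hac.comp (by fun_prop)).continuousAt.rpow continuousAt_id
            (Or.inl (by simpa using (hapos 1 zero_le_one).ne'))
      simpa [hα] using this.tendsto.mono_left nhdsWithin_le_nhds
    have hlim1 : Tendsto α (𝓝[<] 1) (𝓝 (C * a 0)) := by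
      have : ContinuousAt α 1 := by
        refine ContinuousAt.mul (continuousAt_const.mul ?_) ?_
        · exact hac.continuousAt.rpow (by fun_prop) (Or.inl (hapos 1 zero_le_one).ne')
        · exact (hac.comp (by fun_prop)).continuousAt.rpow continuousAt_id
            (Or.inl (by simpa using (hapos 0 le_rfl).ne'))
      simpa [hα] using this.tendsto.mono_left nhdsWithin_le_nhds
    have hfin := norm_le_interp_of_tendsto hud huB huα huα hlim0 hlim1 hz₀
    have hu0 : u z₀ = h z₀ p := by simp [hu, hφz, hψz]
    have hCa : 0 ≤ C * a 0 := mul_nonneg hC (hapos 0 le_rfl).le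
    rw [hu0] at hfin
    exact (hfin.trans (rpow_one_sub_mul_rpow_le hCa hCa le_rfl le_rfl hz₀.1 hz₀.2)).trans
      (by rw [ha0])
  have hκlim : Tendsto (fun ν : ℝ => √(ν / π) * ν⁻¹) atTop (𝓝 0) := by
    have h1 : Tendsto (fun ν : ℝ => (√π)⁻¹ * (√ν)⁻¹) atTop (𝓝 0) := by
      simpa using (tendsto_inv_atTop_zero.comp Real.tendsto_sqrt_atTop).const_mul (√π)⁻¹
    refine h1.congr' ?_
    filter_upwards [eventually_gt_atTop 0] with ν hν
    rw [Real.sqrt_div hν.le]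
    have := Real.sq_sqrt hν.le
    have h3 : √ν ≠ 0 := (Real.sqrt_pos.2 hν).ne'
    field_simp
    rw [this]
  have hlim : Tendsto (fun ν : ℝ => C * (R + Λ * (√(ν / π) * ν⁻¹))) atTop (𝓝 (C * R)) := by
    simpa using ((hκlim.const_mul Λ).const_add R).const_mul C
  refine ge_of_tendsto hlim ?_
  filter_upwards [eventually_gt_atTop 0] with ν hν using key ν hν

/-- The conformal map of the unit strip onto the unit disk that sends `θ` to `0`. -/
noncomputable def stripToDisk (θ : ℝ) (z : ℂ) : ℂ :=
  (cexp (π * I * z) - cexp (π * θ * I)) / (cexp (π * I * z) - cexp (-(π * θ * I)))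

theorem cexp_pi_mul_I_mul (z : ℂ) : cexp (π * I * z) =
    (Real.exp (-π * z.im) * Real.cos (π * z.re) : ℝ) +
      (Real.exp (-π * z.im) * Real.sin (π * z.re) : ℝ) * I := by
  have : (π * I * z : ℂ) = (-π * z.im : ℝ) + (π * z.re : ℝ) * I := by
    apply Complex.ext <;> simp
  rw [this, exp_add, exp_mul_I]
  push_cast
  ring

theorem cexp_pi_mul_theta_mul_I (θ : ℝ) : cexp (π * θ * I) =
    (Real.cos (π * θ) : ℝ) + (Real.sin (π * θ) : ℝ) * I := by
  rw [exp_mul_I]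
  push_cast
  rfl

theorem cexp_neg_pi_mul_theta_mul_I (θ : ℝ) : cexp (-(π * θ * I)) =
    (Real.cos (π * θ) : ℝ) - (Real.sin (π * θ) : ℝ) * I := by
  rw [← neg_mul, exp_mul_I, cos_neg, sin_neg]
  push_cast
  ring

theorem sin_pi_mul_pos {θ : ℝ} (hθ : θ ∈ Ioo (0 : ℝ) 1) : 0 < Real.sin (π * θ) :=
  Real.sin_pos_of_pos_of_lt_pi (by have := hθ.1; positivity) (by nlinarith [hθ.2, Real.pi_pos])

theorem im_cexp_pi_mul_nonneg {z : ℂ} (hz : z ∈ re ⁻¹' Icc (0 : ℝ) 1) :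
    0 ≤ (cexp (π * I * z)).im := by
  rw [cexp_pi_mul_I_mul]
  simp only [add_im, ofReal_im, mul_im, ofReal_re, I_im, I_re, mul_one, mul_zero, zero_add, add_zero]
  exact mul_nonneg (Real.exp_pos _).le (Real.sin_nonneg_of_nonneg_of_le_pi
    (mul_nonneg Real.pi_pos.le hz.1) (by nlinarith [hz.2, Real.pi_pos]))

theorem im_cexp_pi_mul_pos {z : ℂ} (hz : z ∈ Sopen) : 0 < (cexp (π * I * z)).im := by
  rw [cexp_pi_mul_I_mul]
  simp only [add_im, ofReal_im, mul_im, ofReal_re, I_im, I_re, mul_one, mul_zero, zero_add, add_zero]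
  exact mul_pos (Real.exp_pos _) (sin_pi_mul_pos hz)

theorem sin_le_norm_cexp_sub {θ : ℝ} {z : ℂ} (hz : z ∈ re ⁻¹' Icc (0 : ℝ) 1) :
    Real.sin (π * θ) ≤ ‖cexp (π * I * z) - cexp (-(π * θ * I))‖ := by
  refine le_trans ?_ (abs_im_le_norm _)
  refine le_trans ?_ (le_abs_self _)
  rw [sub_im, cexp_neg_pi_mul_theta_mul_I]
  have := im_cexp_pi_mul_nonneg hz
  generalize Real.sin (π * θ) = s
  simp only [sub_im, ofReal_im, mul_im, ofReal_re, I_im, I_re]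
  linarith

theorem cexp_sub_ne_zero {θ : ℝ} (hθ : θ ∈ Ioo (0 : ℝ) 1) {z : ℂ} (hz : z ∈ re ⁻¹' Icc (0 : ℝ) 1) :
    cexp (π * I * z) - cexp (-(π * θ * I)) ≠ 0 :=
  norm_pos_iff.1 ((sin_pi_mul_pos hθ).trans_le (sin_le_norm_cexp_sub hz))

theorem Sopen_subset_closedStrip : Sopen ⊆ re ⁻¹' Icc (0 : ℝ) 1 := fun _ hz => ⟨hz.1.le, hz.2.le⟩

theorem stripToDisk_theta (θ : ℝ) : stripToDisk θ θ = 0 := by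
  have : (π * I * θ : ℂ) = π * θ * I := by ring
  rw [stripToDisk, this, sub_self, zero_div]

theorem normSq_cexp_sub (θ : ℝ) (z : ℂ) :
    ‖cexp (π * I * z) - cexp (π * θ * I)‖ ^ 2 + 4 * Real.sin (π * θ) * (cexp (π * I * z)).im =
      ‖cexp (π * I * z) - cexp (-(π * θ * I))‖ ^ 2 := by
  rw [cexp_pi_mul_theta_mul_I, cexp_neg_pi_mul_theta_mul_I, Complex.sq_norm, Complex.sq_norm,
    normSq_apply, normSq_apply]
  generalize Real.sin (π * θ) = s, Real.cos (π * θ) = c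
  simp only [sub_im, sub_re, add_re, add_im, ofReal_im, mul_im, mul_re, ofReal_re, I_im, I_re]
  ring

theorem norm_stripToDisk_le_one {θ : ℝ} (hθ : θ ∈ Ioo (0 : ℝ) 1) {z : ℂ}
    (hz : z ∈ re ⁻¹' Icc (0 : ℝ) 1) : ‖stripToDisk θ z‖ ≤ 1 := by
  rw [stripToDisk, norm_div]
  refine div_le_one_of_le₀ ?_ (norm_nonneg _)
  rw [← sq_le_sq₀ (norm_nonneg _) (norm_nonneg _), ← normSq_cexp_sub]
  have := mul_nonneg (sin_pi_mul_pos hθ).le (im_cexp_pi_mul_nonneg hz)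
  linarith

theorem norm_stripToDisk_lt_one {θ : ℝ} (hθ : θ ∈ Ioo (0 : ℝ) 1) {z : ℂ}
    (hz : z ∈ Sopen) : ‖stripToDisk θ z‖ < 1 := by
  rw [stripToDisk, norm_div,
    div_lt_one (norm_pos_iff.2 (cexp_sub_ne_zero hθ (Sopen_subset_closedStrip hz))),
    ← sq_lt_sq₀ (norm_nonneg _) (norm_nonneg _), ← normSq_cexp_sub]
  have := mul_pos (sin_pi_mul_pos hθ) (im_cexp_pi_mul_pos hz)
  linarith

theorem one_sub_stripToDisk {θ : ℝ} (hθ : θ ∈ Ioo (0 : ℝ) 1) {z : ℂ}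
    (hz : z ∈ re ⁻¹' Icc (0 : ℝ) 1) : 1 - stripToDisk θ z =
      (cexp (π * θ * I) - cexp (-(π * θ * I))) / (cexp (π * I * z) - cexp (-(π * θ * I))) := by
  rw [stripToDisk, eq_div_iff (cexp_sub_ne_zero hθ hz), sub_mul,
    div_mul_cancel₀ _ (cexp_sub_ne_zero hθ hz)]
  ring

theorem norm_cexp_theta_sub (θ : ℝ) (hθ : θ ∈ Ioo (0 : ℝ) 1) :
    ‖cexp (π * θ * I) - cexp (-(π * θ * I))‖ = 2 * Real.sin (π * θ) := by
  have : cexp (π * θ * I) - cexp (-(π * θ * I)) = (2 * Real.sin (π * θ) : ℝ) * I := by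
    rw [cexp_pi_mul_theta_mul_I, cexp_neg_pi_mul_theta_mul_I]
    push_cast
    ring
  rw [this, norm_mul, norm_I, norm_real, mul_one,
    Real.norm_of_nonneg (by linarith [sin_pi_mul_pos hθ])]

theorem hasDerivAt_stripToDisk {θ : ℝ} (hθ : θ ∈ Ioo (0 : ℝ) 1) {z : ℂ}
    (hz : z ∈ re ⁻¹' Icc (0 : ℝ) 1) : HasDerivAt (stripToDisk θ)
      ((cexp (π * θ * I) - cexp (-(π * θ * I))) * (cexp (π * I * z) * (π * I)) /
        (cexp (π * I * z) - cexp (-(π * θ * I))) ^ 2) z := by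
  have h1 : HasDerivAt (fun z : ℂ => cexp (π * I * z)) (cexp (π * I * z) * (π * I)) z := by
    simpa using ((hasDerivAt_id z).const_mul (π * I : ℂ)).cexp
  refine ((h1.sub_const _).div (h1.sub_const _) (cexp_sub_ne_zero hθ hz)).congr_deriv ?_
  congr 1
  ring

theorem differentiableOn_stripToDisk {θ : ℝ} (hθ : θ ∈ Ioo (0 : ℝ) 1) :
    DifferentiableOn ℂ (stripToDisk θ) (re ⁻¹' Icc 0 1) := fun _ hz =>
  (hasDerivAt_stripToDisk hθ hz).differentiableAt.differentiableWithinAt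

theorem exists_lipschitz_stripToDisk {θ : ℝ} (hθ : θ ∈ Ioo (0 : ℝ) 1) : ∃ L : ℝ, 0 ≤ L ∧
    ∀ z ∈ re ⁻¹' Icc (0 : ℝ) 1, ∀ w ∈ re ⁻¹' Icc (0 : ℝ) 1,
      ‖stripToDisk θ z - stripToDisk θ w‖ ≤ L * ‖w - z‖ := by
  set σ := Real.sin (π * θ)
  have hσ : 0 < σ := sin_pi_mul_pos hθ
  refine ⟨2 * π * (1 + 1 / σ), by positivity, fun z hz w hw => ?_⟩
  rw [norm_sub_rev w z]
  refine Convex.norm_image_sub_le_of_norm_hasDerivWithin_le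
    (fun x hx => (hasDerivAt_stripToDisk hθ hx).hasDerivWithinAt) (fun x hx => ?_)
    ((convex_Icc (0 : ℝ) 1).linear_preimage reLm) hw hz
  set d := ‖cexp (π * I * x) - cexp (-(π * θ * I))‖
  have hd : σ ≤ d := sin_le_norm_cexp_sub hx
  have hd0 : 0 < d := hσ.trans_le hd
  have hE : ‖cexp (π * I * x)‖ ≤ d + 1 := by
    have h1 := norm_sub_norm_le (cexp (π * I * x)) (cexp (-(π * θ * I)))
    have h2 : ‖cexp (-(π * θ * I))‖ = 1 := by
      rw [show (-(π * θ * I) : ℂ) = ((-(π * θ) : ℝ) : ℂ) * I by push_cast; ring,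
        norm_exp_ofReal_mul_I]
    rw [h2] at h1
    linarith
  rw [norm_div, norm_mul, norm_cexp_theta_sub θ hθ, norm_mul, norm_mul, norm_I, norm_real, mul_one,
    Real.norm_of_nonneg Real.pi_pos.le, norm_pow, div_le_iff₀ (by positivity)]
  calc 2 * σ * (‖cexp (π * I * x)‖ * π) ≤ 2 * d * ((d + 1 / σ * d) * π) := by
        have : 1 ≤ 1 / σ * d := by
          rw [one_div, ← div_eq_inv_mul, le_div_iff₀ hσ]
          linarith
        gcongr
        linarith
    _ = _ := by ring

/-- The angle of the point of the unit circle that corresponds to the real number `r`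
under the conformal map of the upper half-plane onto the disk. -/
noncomputable def circleAngle (θ r : ℝ) : ℝ :=
  π + 2 * Real.arctan ((r - Real.cos (π * θ)) / Real.sin (π * θ))

theorem continuous_circleAngle (θ : ℝ) : Continuous (circleAngle θ) := by
  unfold circleAngle
  fun_prop

theorem circleAngle_zero {θ : ℝ} (hθ : θ ∈ Ioo (0 : ℝ) 1) : circleAngle θ 0 = 2 * π * θ := by
  have h : (0 - Real.cos (π * θ)) / Real.sin (π * θ) = -Real.tan (π / 2 - π * θ) := by
    rw [Real.tan_pi_div_two_sub, Real.tan_eq_sin_div_cos, inv_div, zero_sub, neg_div]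
  rw [circleAngle, h, Real.arctan_neg, Real.arctan_tan]
  · ring
  · nlinarith [hθ.2, Real.pi_pos]
  · nlinarith [hθ.1, Real.pi_pos]

theorem monotone_circleAngle {θ : ℝ} (hθ : θ ∈ Ioo (0 : ℝ) 1) : Monotone (circleAngle θ) := by
  intro r r' h
  have := sin_pi_mul_pos hθ
  unfold circleAngle
  have h2 := Real.arctan_mono (a := (r - Real.cos (π * θ)) / Real.sin (π * θ))
    (b := (r' - Real.cos (π * θ)) / Real.sin (π * θ)) (by gcongr)
  linarith

theorem circleAngle_mem_of_nonneg {θ : ℝ} (hθ : θ ∈ Ioo (0 : ℝ) 1) {r : ℝ} (hr : 0 ≤ r) :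
    circleAngle θ r ∈ Icc (2 * π * θ) (2 * π) := by
  refine ⟨circleAngle_zero hθ ▸ monotone_circleAngle hθ hr, ?_⟩
  have := Real.arctan_lt_pi_div_two ((r - Real.cos (π * θ)) / Real.sin (π * θ))
  unfold circleAngle
  linarith

theorem circleAngle_mem_of_nonpos {θ : ℝ} (hθ : θ ∈ Ioo (0 : ℝ) 1) {r : ℝ} (hr : r ≤ 0) :
    circleAngle θ r ∈ Icc 0 (2 * π * θ) := by
  refine ⟨?_, circleAngle_zero hθ ▸ monotone_circleAngle hθ hr⟩
  have := Real.neg_pi_div_two_lt_arctan ((r - Real.cos (π * θ)) / Real.sin (π * θ))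
  unfold circleAngle
  linarith

theorem stripToDisk_eq_cexp_circleAngle {θ : ℝ} (hθ : θ ∈ Ioo (0 : ℝ) 1) {z : ℂ} {r : ℝ}
    (hz : cexp (π * I * z) = r) : stripToDisk θ z = cexp (circleAngle θ r * I) := by
  have hs := sin_pi_mul_pos hθ
  rw [stripToDisk, hz, cexp_pi_mul_theta_mul_I, cexp_neg_pi_mul_theta_mul_I, circleAngle]
  set u := (r - Real.cos (π * θ)) / Real.sin (π * θ) with hu
  have hr : r = Real.cos (π * θ) + Real.sin (π * θ) * u := by
    rw [hu]
    field_simp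
    ring
  set c := Real.cos (π * θ)
  set s := Real.sin (π * θ)
  have hsq : 0 < 1 + u ^ 2 := by positivity
  have hsq' : ((√(1 + u ^ 2) : ℝ) : ℂ) ^ 2 = 1 + u ^ 2 := by
    rw [← ofReal_pow, Real.sq_sqrt hsq.le]
    push_cast
    rfl
  have hne : ((√(1 + u ^ 2) : ℝ) : ℂ) ≠ 0 := by
    exact_mod_cast (Real.sqrt_pos.2 hsq).ne'
  have hexp : cexp (Real.arctan u * I) = (1 + u * I) / (√(1 + u ^ 2) : ℝ) := by
    rw [exp_mul_I, ← ofReal_cos, ← ofReal_sin, Real.cos_arctan, Real.sin_arctan]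
    push_cast
    field_simp
  have hrhs : cexp ((π + 2 * Real.arctan u : ℝ) * I) = -((1 + u * I) ^ 2 / (1 + u ^ 2)) := by
    have : (((π + 2 * Real.arctan u : ℝ) : ℂ) * I) =
        π * I + (Real.arctan u * I + Real.arctan u * I) := by
      push_cast
      ring
    rw [this, exp_add, exp_pi_mul_I, exp_add, hexp, ← hsq']
    field_simp
  have hs' : (s : ℂ) ≠ 0 := by exact_mod_cast hs.ne'
  have h1 : (r - (c - s * I) : ℂ) = s * (u + I) := by
    rw [hr]
    push_cast
    ring
  have h2 : (r - (c + s * I) : ℂ) = s * (u - I) := by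
    rw [hr]
    push_cast
    ring
  have h3 : (u + I : ℂ) ≠ 0 := fun h => by simpa using congrArg Complex.im h
  have h4 : (1 + u ^ 2 : ℂ) = (u + I) * (u - I) := by
    linear_combination I_sq
  have h5 : (u - I : ℂ) ≠ 0 := fun h => by simpa using congrArg Complex.im h
  rw [hrhs, h1, h2, h4, mul_div_mul_left _ _ hs', ← neg_div, div_eq_div_iff h3 (mul_ne_zero h3 h5)]
  linear_combination (u + I) * (1 + u ^ 2) * I_sq

theorem CalderonDiskFun.norm_g0_le {θ : ℝ} {i0 : X0 →L[ℂ] E} {i1 : X1 →L[ℂ] E}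
    (f : CalderonDiskFun θ i0 i1) {t : ℝ} (ht : t ∈ Icc (2 * π * θ) (2 * π)) :
    ‖f.g0 t‖ ≤ f.norm :=
  (le_csSup (isCompact_Icc.image_of_continuousOn f.cont_g0.norm).bddAbove ⟨t, ht, rfl⟩).trans
    (le_max_left _ _)

theorem CalderonDiskFun.norm_g1_le {θ : ℝ} {i0 : X0 →L[ℂ] E} {i1 : X1 →L[ℂ] E}
    (f : CalderonDiskFun θ i0 i1) {t : ℝ} (ht : t ∈ Icc 0 (2 * π * θ)) :
    ‖f.g1 t‖ ≤ f.norm :=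
  (le_csSup (isCompact_Icc.image_of_continuousOn f.cont_g1.norm).bddAbove ⟨t, ht, rfl⟩).trans
    (le_max_right _ _)

theorem cexp_pi_mul_zero_add (s : ℝ) :
    cexp (π * I * ((0 : ℝ) + s * I)) = (Real.exp (-π * s) : ℝ) := by
  rw [cexp_pi_mul_I_mul]
  simp

theorem cexp_pi_mul_one_add (s : ℝ) :
    cexp (π * I * ((1 : ℝ) + s * I)) = (-Real.exp (-π * s) : ℝ) := by
  rw [cexp_pi_mul_I_mul]
  simp

theorem norm_apply_le_mul_norm [CompleteSpace X0] [CompleteSpace X1] [CompleteSpace E]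
    {θ : ℝ} (hθ : θ ∈ Ioo (0 : ℝ) 1)
    {i0 : X0 →L[ℂ] E} {i1 : X1 →L[ℂ] E} {h : ℂ → (interSub i0 i1 →ₗ[ℂ] ℂ)} {C : ℝ} (hC : 0 ≤ C)
    (hbound : ∀ b : interSub i0 i1, ∀ z ∈ Sopen,
      ‖h z b‖ ≤ C * nzero i0 i1 b ^ (1 - z.re) * none' i0 i1 b ^ z.re)
    (hdiff : ∀ b : interSub i0 i1, DifferentiableOn ℂ (fun z => h z b) Sopen)
    (p : interSub i0 i1) (f : CalderonDiskFun θ i0 i1) (hf : f.toFun 0 = i0 (p : X0 × X1).1) :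
    ‖h θ p‖ ≤ C * f.norm := by
  obtain ⟨L, hL, hLip⟩ := exists_lipschitz_stripToDisk hθ
  set gd : ℂ → E := dslope f.toFun 0 with hgd
  have hball : Metric.ball (0 : ℂ) 1 ∈ 𝓝 (0 : ℂ) := Metric.ball_mem_nhds _ one_pos
  have hcball : Metric.closedBall (0 : ℂ) 1 ∈ 𝓝 (0 : ℂ) := Metric.closedBall_mem_nhds _ one_pos
  have hgdc : ContinuousOn gd (Metric.closedBall 0 1) :=
    (continuousOn_dslope hcball).2 ⟨f.cont, f.anal.differentiableAt hball⟩
  have hgdd : DifferentiableOn ℂ gd (Metric.ball 0 1) :=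
    (Complex.differentiableOn_dslope hball).2 f.anal
  obtain ⟨B, hB⟩ := (isCompact_closedBall (0 : ℂ) 1).exists_bound_of_continuousOn hgdc
  have hmaps : MapsTo (stripToDisk θ) (re ⁻¹' Icc 0 1) (Metric.closedBall 0 1) := fun z hz => by
    simpa using norm_stripToDisk_le_one hθ hz
  have hmaps' : MapsTo (stripToDisk θ) Sopen (Metric.ball 0 1) := fun z hz => by
    simpa using norm_stripToDisk_lt_one hθ hz
  have hslope : ∀ w : ℂ, w ≠ 0 → gd w = w⁻¹ • (f.toFun w - i0 (p : X0 × X1).1) := fun w hw => by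
    rw [hgd, dslope_of_ne _ hw, slope_def_module, sub_zero, hf]
  have hp : i0 (p : X0 × X1).1 = i1 (p : X0 × X1).2 := p.2
  have hW0 := fun s : ℝ => stripToDisk_eq_cexp_circleAngle hθ (cexp_pi_mul_zero_add s)
  have hW1 := fun s : ℝ => stripToDisk_eq_cexp_circleAngle hθ (cexp_pi_mul_one_add s)
  have ht0 := fun s : ℝ => circleAngle_mem_of_nonneg hθ (Real.exp_pos (-π * s)).le
  have ht1 := fun s : ℝ => circleAngle_mem_of_nonpos hθ (neg_nonpos.2 (Real.exp_pos (-π * s)).le)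
  have hcont0 : Continuous fun s : ℝ => circleAngle θ (Real.exp (-π * s)) :=
    (continuous_circleAngle θ).comp (by fun_prop)
  have hcont1 : Continuous fun s : ℝ => circleAngle θ (-Real.exp (-π * s)) :=
    (continuous_circleAngle θ).comp (by fun_prop)
  have hinv : Continuous fun t : ℝ => (cexp (t * I))⁻¹ :=
    Continuous.inv₀ (by fun_prop) fun t => exp_ne_zero _
  refine norm_apply_le_of_strip hC hbound hdiff (g := gd ∘ stripToDisk θ) (B := B)
    (hgdc.comp (differentiableOn_stripToDisk hθ).continuousOn hmaps)
    (hgdd.comp ((differentiableOn_stripToDisk hθ).mono Sopen_subset_closedStrip) hmaps')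
    (fun z hz => hB _ (hmaps hz))
    (G0 := fun s => (cexp (circleAngle θ (Real.exp (-π * s)) * I))⁻¹ •
      (f.g0 (circleAngle θ (Real.exp (-π * s))) - (p : X0 × X1).1))
    (G1 := fun s => (cexp (circleAngle θ (-Real.exp (-π * s)) * I))⁻¹ •
      (f.g1 (circleAngle θ (-Real.exp (-π * s))) - (p : X0 × X1).2))
    ((hinv.comp hcont0).smul ((f.cont_g0.comp_continuous hcont0 ht0).sub continuous_const))
    ((hinv.comp hcont1).smul ((f.cont_g1.comp_continuous hcont1 ht1).sub continuous_const))
    (B0 := f.norm + ‖(p : X0 × X1).1‖) (B1 := f.norm + ‖(p : X0 × X1).2‖)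
    (fun s => ?_) (fun s => ?_) (fun s => ?_) (fun s => ?_)
    (φ := fun _ => 1) (ψ := stripToDisk θ) (differentiableOn_const _)
    ((differentiableOn_stripToDisk hθ).mono Sopen_subset_closedStrip) hL
    (fun z _ w _ => by simpa using by positivity) hLip p (fun s => ?_) (fun s => ?_)
    (by simpa [Sopen] using hθ) rfl (stripToDisk_theta θ)
  · rw [norm_smul, norm_inv, norm_exp_ofReal_mul_I, inv_one, one_mul]
    exact (norm_sub_le _ _).trans (add_le_add_left (f.norm_g0_le (ht0 s)) _)
  · rw [norm_smul, norm_inv, norm_exp_ofReal_mul_I, inv_one, one_mul]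
    exact (norm_sub_le _ _).trans (add_le_add_left (f.norm_g1_le (ht1 s)) _)
  · rw [Function.comp_apply, hW0, hslope _ (exp_ne_zero _), map_smul, map_sub, f.eq_g0 _ (ht0 s)]
  · rw [Function.comp_apply, hW1, hslope _ (exp_ne_zero _), map_smul, map_sub, f.eq_g1 _ (ht1 s),
      hp]
  · rw [hW0, smul_smul, mul_inv_cancel₀ (exp_ne_zero _), one_smul, one_smul, add_sub_cancel]
    exact f.norm_g0_le (ht0 s)
  · rw [hW1, smul_smul, mul_inv_cancel₀ (exp_ne_zero _), one_smul, one_smul, add_sub_cancel]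
    exact f.norm_g1_le (ht1 s)

theorem CalderonDiskFun.norm_nonneg {θ : ℝ} (hθ : θ ∈ Ioo (0 : ℝ) 1) {i0 : X0 →L[ℂ] E}
    {i1 : X1 →L[ℂ] E} (f : CalderonDiskFun θ i0 i1) : 0 ≤ f.norm :=
  (_root_.norm_nonneg _).trans (f.norm_g0_le (t := 2 * π)
    ⟨by nlinarith [hθ.2, Real.pi_pos], le_rfl⟩)

theorem interpNorm_le_norm {θ : ℝ} (hθ : θ ∈ Ioo (0 : ℝ) 1) {i0 : X0 →L[ℂ] E} {i1 : X1 →L[ℂ] E}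
    (f : CalderonDiskFun θ i0 i1) : interpNorm θ i0 i1 (f.toFun 0) ≤ f.norm := by
  refine csInf_le ⟨0, ?_⟩ ⟨f, rfl, rfl⟩
  rintro r ⟨g, -, rfl⟩
  exact g.norm_nonneg hθ

/-- The element of Calderón's disk space defined by an analytic function with values in the
intersection of the couple. -/
noncomputable def CalderonDiskFun.ofInter {θ : ℝ} {i0 : X0 →L[ℂ] E} {i1 : X1 →L[ℂ] E}
    (q : ℂ → interSub i0 i1) (hqc : ContinuousOn q (Metric.closedBall 0 1))
    (hqd : DifferentiableOn ℂ q (Metric.ball 0 1)) (h1 : q 1 = 0)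
    (hω : q (cexp ((2 * π * θ : ℝ) * I)) = 0) : CalderonDiskFun θ i0 i1 where
  toFun w := i0 (q w : X0 × X1).1
  g0 t := (q (cexp (t * I)) : X0 × X1).1
  g1 t := (q (cexp (t * I)) : X0 × X1).2
  cont := (i0.continuous.comp (continuous_fst.comp continuous_subtype_val)).comp_continuousOn hqc
  anal := ((i0.comp (ContinuousLinearMap.fst ℂ X0 X1)).comp
    (interSub i0 i1).subtypeL).differentiable.comp_differentiableOn hqd
  vanish_one := by simp [h1]
  vanish_theta := by rw [hω]; simp
  cont_g0 := ((continuous_fst.comp continuous_subtype_val).comp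
    (hqc.comp_continuous (by fun_prop) fun t => by simp)).continuousOn
  cont_g1 := ((continuous_snd.comp continuous_subtype_val).comp
    (hqc.comp_continuous (by fun_prop) fun t => by simp)).continuousOn
  eq_g0 _ _ := rfl
  eq_g1 _ _ := (q _).2.symm

theorem norm_apply_le_of_boundary_le_one {θ : ℝ} (hθ : θ ∈ Ioo (0 : ℝ) 1) {i0 : X0 →L[ℂ] E}
    {i1 : X1 →L[ℂ] E} {y : interSub i0 i1 →ₗ[ℂ] ℂ} {M : ℝ}
    (hy : ∀ p : interSub i0 i1, interpNorm θ i0 i1 (i0 (p : X0 × X1).1) ≤ 1 → ‖y p‖ ≤ M)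
    {q : ℂ → interSub i0 i1} (hqc : ContinuousOn q (Metric.closedBall 0 1))
    (hqd : DifferentiableOn ℂ q (Metric.ball 0 1)) (h1 : q 1 = 0)
    (hω : q (cexp ((2 * π * θ : ℝ) * I)) = 0)
    (hq0 : ∀ t ∈ Icc (2 * π * θ) (2 * π), ‖(q (cexp (t * I)) : X0 × X1).1‖ ≤ 1)
    (hq1 : ∀ t ∈ Icc 0 (2 * π * θ), ‖(q (cexp (t * I)) : X0 × X1).2‖ ≤ 1) : ‖y (q 0)‖ ≤ M := by
  refine hy _ ((interpNorm_le_norm hθ (CalderonDiskFun.ofInter q hqc hqd h1 hω)).trans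
    (max_le (csSup_le ?_ ?_) (csSup_le ?_ ?_)))
  · exact (nonempty_Icc.2 (by nlinarith [hθ.2, Real.pi_pos])).image _
  · rintro _ ⟨t, ht, rfl⟩
    exact hq0 t ht
  · exact (nonempty_Icc.2 (by have := hθ.1; positivity)).image _
  · rintro _ ⟨t, ht, rfl⟩
    exact hq1 t ht

theorem exists_entire_of_mem_span_fourier [Fact (0 < 2 * π)] {P : C(AddCircle (2 * π), ℂ)}
    (hP : P ∈ Submodule.span ℂ (range (fourier (T := 2 * π)))) :
    ∃ Q₁ Q₂ : ℂ → ℂ, Differentiable ℂ Q₁ ∧ Differentiable ℂ Q₂ ∧ ∀ t : ℝ,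
      P t = Q₁ (cexp (t * I)) + (starRingEnd ℂ) (Q₂ (cexp (t * I))) := by
  induction hP using Submodule.span_induction with
  | mem P h =>
    obtain ⟨n, rfl⟩ := h
    have hF : ∀ t : ℝ, fourier n (t : AddCircle (2 * π)) = cexp (t * I) ^ n := fun t => by
      rw [fourier_coe_apply, ← exp_int_mul]
      congr 1
      have : (π : ℂ) ≠ 0 := by exact_mod_cast Real.pi_ne_zero
      push_cast
      field_simp
    obtain ⟨m, rfl | rfl⟩ := n.eq_nat_or_neg
    · refine ⟨fun z => z ^ m, fun _ => 0, by fun_prop, by fun_prop, fun t => ?_⟩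
      simp only [hF, zpow_natCast, map_zero, add_zero]
    · refine ⟨fun _ => 0, fun z => z ^ m, by fun_prop, by fun_prop, fun t => ?_⟩
      simp only [hF, zpow_neg, zpow_natCast, zero_add, map_pow, ← exp_conj, map_mul, conj_ofReal,
        conj_I, mul_neg, exp_neg, inv_pow]
  | zero => exact ⟨fun _ => 0, fun _ => 0, by fun_prop, by fun_prop, fun t => by simp⟩
  | add P P' _ _ h h' =>
    obtain ⟨Q₁, Q₂, h₁, h₂, hQ⟩ := h
    obtain ⟨Q₁', Q₂', h₁', h₂', hQ'⟩ := h'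
    refine ⟨Q₁ + Q₁', Q₂ + Q₂', h₁.add h₁', h₂.add h₂', fun t => ?_⟩
    simp only [ContinuousMap.add_apply, hQ, hQ', Pi.add_apply, map_add]
    ring
  | smul c P _ h =>
    obtain ⟨Q₁, Q₂, h₁, h₂, hQ⟩ := h
    refine ⟨fun z => c * Q₁ z, fun z => (starRingEnd ℂ) c * Q₂ z, h₁.const_mul _, h₂.const_mul _,
      fun t => ?_⟩
    simp only [ContinuousMap.smul_apply, hQ, smul_eq_mul, map_mul, conj_conj]
    ring

theorem exists_entire_re_approx {F : ℝ → ℝ} (hF : ContinuousOn F (Icc 0 (2 * π)))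
    (h0 : F 0 = F (2 * π)) {ε : ℝ} (hε : 0 < ε) : ∃ Q : ℂ → ℂ, Differentiable ℂ Q ∧
      ∀ t ∈ Icc 0 (2 * π), |(Q (cexp (t * I))).re - F t| ≤ ε := by
  have : Fact (0 < 2 * π) := ⟨Real.two_pi_pos⟩
  set G : C(AddCircle (2 * π), ℂ) := ⟨AddCircle.liftIco (2 * π) 0 fun t => (F t : ℂ),
    AddCircle.liftIco_zero_continuous (by rw [h0]) (continuous_ofReal.comp_continuousOn hF)⟩
  have hG : G ∈ (Submodule.span ℂ (range (fourier (T := 2 * π)))).topologicalClosure := by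
    rw [span_fourier_closure_eq_top]
    trivial
  obtain ⟨P, hP, hGP⟩ := Metric.mem_closure_iff.1 hG ε hε
  obtain ⟨Q₁, Q₂, h₁, h₂, hQ⟩ := exists_entire_of_mem_span_fourier hP
  have key : ∀ t ∈ Ico 0 (2 * π), |(Q₁ (cexp (t * I)) + Q₂ (cexp (t * I))).re - F t| ≤ ε := by
    intro t ht
    have hGt : G t = F t :=
      AddCircle.liftIco_coe_apply (p := 2 * π) (a := 0) (f := fun t => (F t : ℂ))
        (by simpa using ht)
    have h3 : (Q₁ (cexp (t * I)) + Q₂ (cexp (t * I))).re - F t = (P t - G t).re := by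
      rw [hQ, hGt]
      simp
    rw [h3]
    refine (abs_re_le_norm _).trans ?_
    rw [← ContinuousMap.sub_apply]
    refine (ContinuousMap.norm_coe_le_norm _ _).trans ?_
    rw [← dist_eq_norm, dist_comm]
    exact hGP.le
  refine ⟨fun z => Q₁ z + Q₂ z, h₁.add h₂, fun t ht => ?_⟩
  rcases ht.2.lt_or_eq with h | h
  · exact key t ⟨ht.1, h⟩
  · have := key 0 ⟨le_rfl, Real.two_pi_pos⟩
    rw [h, ← h0]
    have h4 : cexp ((2 * π : ℝ) * I) = cexp ((0 : ℝ) * I) := by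
      push_cast
      rw [exp_two_pi_mul_I]
      simp
    rw [h4]
    exact this

theorem apply_zero_eq_integral [CompleteSpace X] {q : ℂ → X}
    (hqc : ContinuousOn q (Metric.closedBall 0 1)) (hqd : DifferentiableOn ℂ q (Metric.ball 0 1)) :
    q 0 = (2 * π)⁻¹ • ∫ t in 0..2 * π, q (cexp (t * I)) := by
  have h : DiffContOnCl ℂ q (Metric.ball 0 |1|) := by
    rw [abs_one]
    exact ⟨hqd, by rwa [closure_ball _ one_ne_zero]⟩
  rw [← h.circleAverage, Real.circleAverage]
  simp only [circleMap_zero, ofReal_one, one_mul]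

/-- The mean over the circle of the `X₀`-norm on one arc and of the `X₁`-norm on the other. -/
noncomputable def arcMean (θ : ℝ) (u : ℝ → X0 × X1) : ℝ :=
  (2 * π)⁻¹ * ((∫ t in 2 * π * θ..2 * π, ‖(u t).1‖) + ∫ t in 0..2 * π * θ, ‖(u t).2‖)

theorem norm_apply_le_arcMean_of_vanish {θ : ℝ} (hθ : θ ∈ Ioo (0 : ℝ) 1) {i0 : X0 →L[ℂ] E}
    {i1 : X1 →L[ℂ] E} {y : interSub i0 i1 →ₗ[ℂ] ℂ} {M : ℝ}
    (hy : ∀ p : interSub i0 i1, interpNorm θ i0 i1 (i0 (p : X0 × X1).1) ≤ 1 → ‖y p‖ ≤ M)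
    {q : ℂ → interSub i0 i1} (hqc : ContinuousOn q (Metric.closedBall 0 1))
    (hqd : DifferentiableOn ℂ q (Metric.ball 0 1)) (h1 : q 1 = 0)
    (hω : q (cexp ((2 * π * θ : ℝ) * I)) = 0) :
    ‖y (q 0)‖ ≤ M * arcMean θ fun t => (q (cexp (t * I)) : X0 × X1) := by
  set u : ℝ → X0 × X1 := fun t => (q (cexp (t * I)) : X0 × X1) with hu
  have huc : Continuous u := continuous_subtype_val.comp
    (hqc.comp_continuous (by fun_prop) fun t => by simp)
  set N := arcMean θ u with hN
  have h2θ : 2 * π * θ ∈ Icc 0 (2 * π) :=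
    ⟨by have := hθ.1; positivity, by nlinarith [hθ.2, Real.pi_pos]⟩
  have hN0 : 0 ≤ N := by
    refine mul_nonneg (by positivity) (add_nonneg ?_ ?_)
    · exact intervalIntegral.integral_nonneg h2θ.2 fun _ _ => norm_nonneg _
    · exact intervalIntegral.integral_nonneg h2θ.1 fun _ _ => norm_nonneg _
  have huω : u (2 * π * θ) = 0 := by rw [hu]; simp only [hω, Submodule.coe_zero]
  have hu0 : u 0 = 0 := by simp [hu, h1]
  have hu2 : u (2 * π) = 0 := by
    simp only [hu, ofReal_mul, ofReal_ofNat, exp_two_pi_mul_I, h1, Submodule.coe_zero]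
  set n : ℝ → ℝ := fun t => if t ≤ 2 * π * θ then ‖(u t).2‖ else ‖(u t).1‖ with hn
  have hnc : Continuous n := by
    refine Continuous.if_le (by fun_prop) (by fun_prop) continuous_id continuous_const ?_
    rintro t rfl
    simp [huω]
  have hn1 : ∀ t ∈ Icc 0 (2 * π * θ), n t = ‖(u t).2‖ := fun t ht => if_pos ht.2
  have hn0 : ∀ t ∈ Icc (2 * π * θ) (2 * π), n t = ‖(u t).1‖ := fun t ht => by
    rcases ht.1.eq_or_lt with h | h
    · rw [← h]
      simp [hn, huω]
    · exact if_neg h.not_ge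
  have hnint : ∫ t in 0..2 * π, n t = 2 * π * N := by
    rw [← intervalIntegral.integral_add_adjacent_intervals (hnc.intervalIntegrable 0 (2 * π * θ))
      (hnc.intervalIntegrable (2 * π * θ) (2 * π)), hN, arcMean,
      mul_inv_cancel_left₀ Real.two_pi_pos.ne', add_comm]
    congr 1
    · exact intervalIntegral.integral_congr fun t ht => hn0 t (by rwa [uIcc_of_le h2θ.2] at ht)
    · exact intervalIntegral.integral_congr fun t ht => hn1 t (by rwa [uIcc_of_le h2θ.1] at ht)
  have key : ∀ c, N < c → ‖y (q 0)‖ ≤ M * c := by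
    intro c hc
    have hc0 : 0 < c := hN0.trans_lt hc
    have hNc : N / c < 1 := (div_lt_one hc0).2 hc
    set ε := (1 - N / c) / 2 with hε
    obtain ⟨Q, hQ, hQn⟩ := exists_entire_re_approx (F := fun t => n t / c)
      (hnc.div_const c).continuousOn (by
        have h3 : n (2 * π) = 0 := by rw [hn0 _ ⟨h2θ.2, le_rfl⟩, hu2]; simp
        have h4 : n 0 = 0 := by rw [hn1 _ ⟨le_rfl, h2θ.1⟩, hu0]; simp
        rw [h3, h4]) (ε := ε) (by linarith)
    have hQ0 : (Q 0).re ≤ N / c + ε := by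
      have h5 := congrArg reCLM (apply_zero_eq_integral hQ.continuous.continuousOn
        hQ.differentiableOn)
      have hQc : Continuous fun t : ℝ => Q (cexp (t * I)) :=
        hQ.continuous.comp (by fun_prop)
      rw [map_smul, ← reCLM.intervalIntegral_comp_comm (hQc.intervalIntegrable _ _)] at h5
      simp only [reCLM_apply] at h5
      rw [h5, smul_eq_mul, inv_mul_le_iff₀ Real.two_pi_pos]
      calc ∫ t in 0..2 * π, (Q (cexp (t * I))).re ≤ ∫ t in 0..2 * π, (n t / c + ε) := by
            refine intervalIntegral.integral_mono_on Real.two_pi_pos.le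
              ((continuous_re.comp hQc).intervalIntegrable _ _)
              (((hnc.div_const c).add continuous_const).intervalIntegrable _ _) fun t ht => ?_
            have := (abs_le.1 (hQn t ht)).2
            linarith
        _ = 2 * π * (N / c + ε) := by
            rw [intervalIntegral.integral_add ((hnc.div_const c).intervalIntegrable _ _)
              (continuous_const.intervalIntegrable _ _), intervalIntegral.integral_div, hnint,
              intervalIntegral.integral_const, smul_eq_mul]
            ring
    set m : ℂ → ℂ := fun z => (c : ℂ)⁻¹ * cexp (1 - (Q z + ε)) with hm
    have hmd : Differentiable ℂ m := by fun_prop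
    have hmn : ∀ z, ‖m z‖ = c⁻¹ * Real.exp (1 - ((Q z).re + ε)) := fun z => by
      rw [hm, norm_mul, norm_exp, norm_inv, norm_real, Real.norm_of_nonneg hc0.le]
      simp
    have hmb : ∀ t ∈ Icc 0 (2 * π), ‖m (cexp (t * I))‖ * n t ≤ 1 := fun t ht => by
      have h6 := (abs_le.1 (hQn t ht)).1
      set ρ := (Q (cexp (t * I))).re + ε
      have h7 : n t ≤ c * ρ := by
        rw [← div_le_iff₀' hc0]
        linarith
      have h8 : ρ ≤ Real.exp (ρ - 1) := by linarith [Real.add_one_le_exp (ρ - 1)]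
      rw [hmn, show 1 - ((Q (cexp (t * I))).re + ε) = -(ρ - 1) by ring, Real.exp_neg, ← mul_inv,
        inv_mul_le_iff₀ (by positivity), mul_one]
      exact h7.trans (by gcongr)
    have h9 := norm_apply_le_of_boundary_le_one hθ hy (q := fun z => m z • q z)
      (hmd.continuous.continuousOn.smul hqc) (hmd.differentiableOn.smul hqd) (by simp [h1])
      (by simp only [hω, smul_zero])
      (fun t ht => by
        have := hmb t ⟨h2θ.1.trans ht.1, ht.2⟩
        rw [hn0 t ht] at this
        rwa [Submodule.coe_smul, Prod.smul_fst, norm_smul])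
      (fun t ht => by
        have := hmb t ⟨ht.1, ht.2.trans h2θ.2⟩
        rw [hn1 t ht] at this
        rwa [Submodule.coe_smul, Prod.smul_snd, norm_smul])
    have h10 : c⁻¹ ≤ ‖m 0‖ := by
      rw [hmn]
      refine le_mul_of_one_le_right (by positivity) (Real.one_le_exp ?_)
      linarith
    simp only [map_smul, norm_smul] at h9
    rw [← div_le_iff₀ hc0, div_eq_inv_mul]
    exact (mul_le_mul_of_nonneg_right h10 (norm_nonneg _)).trans h9
  have hlim : Tendsto (fun c => M * c) (𝓝[>] N) (𝓝 (M * N)) :=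
    (continuous_const.mul continuous_id).continuousWithinAt
  exact ge_of_tendsto hlim (eventually_nhdsWithin_of_forall key)

theorem arcMean_mono {θ : ℝ} (hθ : θ ∈ Ioo (0 : ℝ) 1) {u v : ℝ → X0 × X1} (hu : Continuous u)
    (hv : Continuous v) (h0 : ∀ t, ‖(u t).1‖ ≤ ‖(v t).1‖) (h1 : ∀ t, ‖(u t).2‖ ≤ ‖(v t).2‖) :
    arcMean θ u ≤ arcMean θ v := by
  have hfst : ∀ {w : ℝ → X0 × X1}, Continuous w → Continuous fun t => ‖(w t).1‖ :=
    fun h => by fun_prop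
  have hsnd : ∀ {w : ℝ → X0 × X1}, Continuous w → Continuous fun t => ‖(w t).2‖ :=
    fun h => by fun_prop
  refine mul_le_mul_of_nonneg_left (add_le_add ?_ ?_) (by positivity)
  · exact intervalIntegral.integral_mono (by nlinarith [hθ.2, Real.pi_pos])
      ((hfst hu).intervalIntegrable _ _) ((hfst hv).intervalIntegrable _ _) h0
  · exact intervalIntegral.integral_mono (by have := hθ.1; positivity)
      ((hsnd hu).intervalIntegrable _ _) ((hsnd hv).intervalIntegrable _ _) h1

theorem norm_one_sub_div_le_one {ρ : ℝ} (hρ : 1 < ρ) {z : ℂ} (hz : ‖z‖ ≤ 1) :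
    ‖(1 - z) / (ρ - z)‖ ≤ 1 := by
  rw [norm_div]
  refine div_le_one_of_le₀ ?_ (norm_nonneg _)
  rw [← sq_le_sq₀ (norm_nonneg _) (norm_nonneg _), Complex.sq_norm, Complex.sq_norm, normSq_apply,
    normSq_apply]
  have := (re_le_norm z).trans hz
  simp only [sub_re, one_re, sub_im, one_im, ofReal_re, ofReal_im]
  nlinarith

theorem ofReal_sub_ne_zero {ρ : ℝ} (hρ : 1 < ρ) {z : ℂ} (hz : ‖z‖ ≤ 1) : (ρ - z : ℂ) ≠ 0 :=
  fun h => by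
    have := (re_le_norm z).trans hz
    rw [← sub_eq_zero.1 h, ofReal_re] at this
    linarith

theorem norm_apply_le_arcMean {θ : ℝ} (hθ : θ ∈ Ioo (0 : ℝ) 1) {i0 : X0 →L[ℂ] E}
    {i1 : X1 →L[ℂ] E} {y : interSub i0 i1 →ₗ[ℂ] ℂ} {M : ℝ} (hM : 0 ≤ M)
    (hy : ∀ p : interSub i0 i1, interpNorm θ i0 i1 (i0 (p : X0 × X1).1) ≤ 1 → ‖y p‖ ≤ M)
    {q : ℂ → interSub i0 i1} (hqc : ContinuousOn q (Metric.closedBall 0 1))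
    (hqd : DifferentiableOn ℂ q (Metric.ball 0 1)) :
    ‖y (q 0)‖ ≤ M * arcMean θ fun t => (q (cexp (t * I)) : X0 × X1) := by
  have hcirc : ∀ t : ℝ, cexp (t * I) ∈ Metric.closedBall (0 : ℂ) 1 := fun t => by simp
  have hucont : ∀ {r : ℂ → interSub i0 i1}, ContinuousOn r (Metric.closedBall 0 1) →
      Continuous fun t : ℝ => (r (cexp (t * I)) : X0 × X1) := fun h =>
    continuous_subtype_val.comp (h.comp_continuous (by fun_prop) hcirc)
  set ω := cexp (-((2 * π * θ : ℝ) * I)) with hω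
  have hωn : ‖ω‖ = 1 := by
    rw [hω, ← neg_mul, ← ofReal_neg, norm_exp_ofReal_mul_I]
  have hωz : ∀ {z : ℂ}, ‖z‖ ≤ 1 → ‖ω * z‖ ≤ 1 := fun h => by rwa [norm_mul, hωn, one_mul]
  have key : ∀ ρ : ℝ, 1 < ρ → ‖y (q 0)‖ ≤
      ρ ^ 2 * (M * arcMean θ fun t => (q (cexp (t * I)) : X0 × X1)) := by
    intro ρ hρ
    set χ : ℂ → ℂ := fun z => (1 - z) / (ρ - z) * ((1 - ω * z) / (ρ - ω * z)) with hχ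
    have hχd : ∀ z ∈ Metric.closedBall (0 : ℂ) 1, DifferentiableAt ℂ χ z := fun z hz => by
      have hz' : ‖z‖ ≤ 1 := by simpa using hz
      have h1 := ofReal_sub_ne_zero hρ hz'
      have h2 := ofReal_sub_ne_zero hρ (hωz hz')
      exact ((differentiableAt_id.const_sub _).div (differentiableAt_id.const_sub _) h1).mul
        (((differentiableAt_id.const_mul _).const_sub _).div
          ((differentiableAt_id.const_mul _).const_sub _) h2)
    have hχc : ContinuousOn χ (Metric.closedBall 0 1) := fun z hz =>
      (hχd z hz).continuousAt.continuousWithinAt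
    have hχn : ∀ z, ‖z‖ ≤ 1 → ‖χ z‖ ≤ 1 := fun z hz => by
      rw [hχ, norm_mul]
      exact mul_le_one₀ (norm_one_sub_div_le_one hρ hz) (norm_nonneg _)
        (norm_one_sub_div_le_one hρ (hωz hz))
    have hχ0 : ‖χ 0‖ = (ρ ^ 2)⁻¹ := by
      simp [hχ, ← sq, abs_of_pos (zero_lt_one.trans hρ)]
    have hq'c := hχc.smul hqc
    have h := norm_apply_le_arcMean_of_vanish hθ hy (q := fun z => χ z • q z) hq'c
      ((show DifferentiableOn ℂ χ (Metric.ball 0 1) from fun z hz =>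
        (hχd z (Metric.ball_subset_closedBall hz)).differentiableWithinAt).smul hqd)
      (by simp [hχ]) (by
        have : ω * cexp ((2 * π * θ : ℝ) * I) = 1 := by
          rw [hω, ← exp_add, neg_add_cancel, exp_zero]
        simp only [hχ, this, sub_self, zero_div, mul_zero, zero_smul])
    rw [map_smul, norm_smul, hχ0, inv_mul_le_iff₀ (by positivity)] at h
    refine h.trans ?_
    gcongr
    have hle : ∀ t : ℝ, ‖χ (cexp (t * I))‖ ≤ 1 := fun t =>
      hχn _ (by rw [norm_exp_ofReal_mul_I])
    exact arcMean_mono hθ (hucont hq'c) (hucont hqc)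
      (fun t => (norm_smul_le _ _).trans (mul_le_of_le_one_left (norm_nonneg _) (hle t)))
      (fun t => (norm_smul_le _ _).trans (mul_le_of_le_one_left (norm_nonneg _) (hle t)))
  have hlim : Tendsto (fun ρ : ℝ => ρ ^ 2 *
      (M * arcMean θ fun t => (q (cexp (t * I)) : X0 × X1))) (𝓝[>] 1)
      (𝓝 (1 ^ 2 * (M * arcMean θ fun t => (q (cexp (t * I)) : X0 × X1)))) :=
    (Continuous.continuousWithinAt (by fun_prop))
  rw [one_pow, one_mul] at hlim
  exact ge_of_tendsto hlim (eventually_nhdsWithin_of_forall key)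

/-- `arcMean` as a seminorm on continuous functions with values in the intersection, multiplied
by a nonnegative constant. -/
noncomputable def arcSeminorm {θ : ℝ} (hθ : θ ∈ Ioo (0 : ℝ) 1) (i0 : X0 →L[ℂ] E)
    (i1 : X1 →L[ℂ] E) {M : ℝ} (hM : 0 ≤ M) : Seminorm ℂ C(ℝ, interSub i0 i1) :=
  Seminorm.of (fun u => M * arcMean θ fun t => (u t : X0 × X1))
    (fun u v => by
      rw [← mul_add]
      refine mul_le_mul_of_nonneg_left ?_ hM
      have hu : Continuous fun t => (u t : X0 × X1) := by fun_prop
      have hv : Continuous fun t => (v t : X0 × X1) := by fun_prop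
      have hu0 : Continuous fun t => ‖(u t : X0 × X1).1‖ := by fun_prop
      have hv0 : Continuous fun t => ‖(v t : X0 × X1).1‖ := by fun_prop
      have hu1 : Continuous fun t => ‖(u t : X0 × X1).2‖ := by fun_prop
      have hv1 : Continuous fun t => ‖(v t : X0 × X1).2‖ := by fun_prop
      simp only [arcMean]
      rw [← mul_add, add_add_add_comm, ← intervalIntegral.integral_add (hu0.intervalIntegrable _ _)
        (hv0.intervalIntegrable _ _), ← intervalIntegral.integral_add (hu1.intervalIntegrable _ _)
        (hv1.intervalIntegrable _ _)]
      refine mul_le_mul_of_nonneg_left (add_le_add ?_ ?_) (by positivity)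
      · refine intervalIntegral.integral_mono (by nlinarith [hθ.2, Real.pi_pos])
          (Continuous.intervalIntegrable (by fun_prop) _ _)
          ((hu0.add hv0).intervalIntegrable _ _) fun t => ?_
        exact norm_add_le _ _
      · refine intervalIntegral.integral_mono (by have := hθ.1; positivity)
          (Continuous.intervalIntegrable (by fun_prop) _ _)
          ((hu1.add hv1).intervalIntegrable _ _) fun t => ?_
        exact norm_add_le _ _)
    (fun c u => by
      simp only [arcMean, ContinuousMap.smul_apply, Submodule.coe_smul, Prod.smul_fst,
        Prod.smul_snd, norm_smul, intervalIntegral.integral_const_mul]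
      ring)

/-- The subspace of boundary values of analytic functions in the space of continuous functions. -/
def boundaryValues (X : Type*) [NormedAddCommGroup X] [NormedSpace ℂ X] :
    Submodule ℂ C(ℝ, X) where
  carrier := {u | ∃ q : ℂ → X, ContinuousOn q (Metric.closedBall 0 1) ∧
    DifferentiableOn ℂ q (Metric.ball 0 1) ∧ ∀ t : ℝ, u t = q (cexp (t * I))}
  add_mem' := by
    rintro u v ⟨q, hq, hq', h⟩ ⟨r, hr, hr', h'⟩
    exact ⟨q + r, hq.add hr, hq'.add hr', fun t => by simp [h, h']⟩
  zero_mem' := ⟨0, continuousOn_const, differentiableOn_const _, fun t => rfl⟩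
  smul_mem' := by
    rintro c u ⟨q, hq, hq', h⟩
    exact ⟨c • q, hq.const_smul c, hq'.const_smul c, fun t => by simp [h]⟩

/-- The functional `u ↦ y (mean of u)` on continuous functions. -/
noncomputable def meanFunctional (y : X →ₗ[ℂ] ℂ) : C(ℝ, X) →ₗ[ℂ] ℂ where
  toFun u := y ((2 * π)⁻¹ • ∫ t in 0..2 * π, u t)
  map_add' u v := by
    simp only [ContinuousMap.add_apply]
    rw [intervalIntegral.integral_add (u.continuous.intervalIntegrable _ _)
      (v.continuous.intervalIntegrable _ _), smul_add, map_add]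
  map_smul' c u := by
    simp only [ContinuousMap.smul_apply, RingHom.id_apply]
    rw [intervalIntegral.integral_smul, smul_comm, map_smul]

theorem exists_functional {θ : ℝ} (hθ : θ ∈ Ioo (0 : ℝ) 1)
    [CompleteSpace X0] [CompleteSpace X1] {i0 : X0 →L[ℂ] E}
    {i1 : X1 →L[ℂ] E} {y : interSub i0 i1 →ₗ[ℂ] ℂ} {M : ℝ} (hM : 0 ≤ M)
    (hy : ∀ p : interSub i0 i1, interpNorm θ i0 i1 (i0 (p : X0 × X1).1) ≤ 1 → ‖y p‖ ≤ M) :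
    ∃ Λ : C(ℝ, interSub i0 i1) →ₗ[ℂ] ℂ,
      (∀ u, ‖Λ u‖ ≤ M * arcMean θ fun t => (u t : X0 × X1)) ∧
      ∀ (u : C(ℝ, interSub i0 i1)) (q : ℂ → interSub i0 i1),
        ContinuousOn q (Metric.closedBall 0 1) → DifferentiableOn ℂ q (Metric.ball 0 1) →
        (∀ t : ℝ, u t = q (cexp (t * I))) → Λ u = y (q 0) := by
  have : CompleteSpace (interSub i0 i1) := (isClosed_interSub i0 i1).completeSpace_coe
  have hmean : ∀ (u : C(ℝ, interSub i0 i1)) (q : ℂ → interSub i0 i1),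
        ContinuousOn q (Metric.closedBall 0 1) → DifferentiableOn ℂ q (Metric.ball 0 1) →
        (∀ t : ℝ, u t = q (cexp (t * I))) → meanFunctional y u = y (q 0) := by
    intro u q hqc hqd hu
    rw [apply_zero_eq_integral hqc hqd]
    simp only [meanFunctional, LinearMap.coe_mk, AddHom.coe_mk, hu]
  obtain ⟨Λ, hΛ, hΛb⟩ := Module.Dual.exists_extension_of_le_seminorm
    (boundaryValues (interSub i0 i1))
    ((meanFunctional y).domRestrict (boundaryValues (interSub i0 i1)))
    (p := arcSeminorm hθ i0 i1 hM) (by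
      rintro ⟨u, q, hqc, hqd, hu⟩
      rw [LinearMap.domRestrict_apply, hmean u q hqc hqd hu]
      refine (norm_apply_le_arcMean hθ hM hy hqc hqd).trans_eq ?_
      simp only [← hu]
      rfl)
  exact ⟨Λ, hΛb, fun u q hqc hqd hu => (hΛ ⟨u, q, hqc, hqd, hu⟩).trans (hmean u q hqc hqd hu)⟩

theorem norm_mul_cexp_neg (w : ℂ) (t : ℝ) : ‖w * cexp (-(t * I))‖ = ‖w‖ := by
  rw [norm_mul, ← neg_mul, ← ofReal_neg, norm_exp_ofReal_mul_I, mul_one]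

theorem re_one_sub_pos {a : ℂ} (ha : ‖a‖ < 1) : 0 < (1 - a).re := by
  have := (re_le_norm a).trans_lt ha
  rw [sub_re, one_re]
  linarith

theorem one_sub_ne_zero_of_norm_lt {a : ℂ} (ha : ‖a‖ < 1) : 1 - a ≠ 0 := fun h => by
  have := re_one_sub_pos ha
  rw [h, zero_re] at this
  exact this.false

/-- The Cauchy kernel of the unit disk. -/
noncomputable def cauchyKernel (w : ℂ) (hw : ‖w‖ < 1) : C(ℝ, ℂ) where
  toFun t := (1 - w * cexp (-(t * I)))⁻¹
  continuous_toFun := Continuous.inv₀ (by fun_prop) fun t =>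
    one_sub_ne_zero_of_norm_lt (by rwa [norm_mul_cexp_neg])

theorem norm_cauchyKernel_le {w : ℂ} (hw : ‖w‖ < 1) {r : ℝ} (hr : r < 1) (hwr : ‖w‖ ≤ r) (t : ℝ) :
    ‖cauchyKernel w hw t‖ ≤ (1 - r)⁻¹ := by
  change ‖(1 - w * cexp (-(t * I)))⁻¹‖ ≤ _
  rw [norm_inv]
  refine inv_anti₀ (by linarith) ?_
  have := norm_sub_norm_le (1 : ℂ) (w * cexp (-(t * I)))
  rw [norm_mul_cexp_neg, norm_one] at this
  linarith

/-- The Poisson kernel of the unit disk. -/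
noncomputable def diskPoisson (w : ℂ) (t : ℝ) : ℝ :=
  1 + 2 * (w * cexp (-(t * I)) / (1 - w * cexp (-(t * I)))).re

theorem continuous_diskPoisson {w : ℂ} (hw : ‖w‖ < 1) : Continuous (diskPoisson w) := by
  have : Continuous fun t : ℝ => w * cexp (-(t * I)) / (1 - w * cexp (-(t * I))) :=
    Continuous.div (by fun_prop) (by fun_prop) fun t =>
      one_sub_ne_zero_of_norm_lt (by rwa [norm_mul_cexp_neg])
  exact continuous_const.add (continuous_const.mul (continuous_re.comp this))

theorem diskPoisson_nonneg {w : ℂ} (hw : ‖w‖ < 1) (t : ℝ) : 0 ≤ diskPoisson w t := by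
  have ha := norm_mul_cexp_neg w t
  rw [diskPoisson]
  set a := w * cexp (-(t * I))
  rw [← ha] at hw
  have h1 : 0 < normSq (1 - a) := normSq_pos.2 (one_sub_ne_zero_of_norm_lt hw)
  have h2 : normSq a < 1 := by
    rw [← Complex.sq_norm]
    exact pow_lt_one₀ (norm_nonneg _) hw two_ne_zero
  rw [div_re, ← add_div, mul_div_assoc', ← sub_nonneg]
  have h3 : 1 + 2 * (a.re * (1 - a).re + a.im * (1 - a).im) / normSq (1 - a) - 0 =
      (1 - normSq a) / normSq (1 - a) := by
    rw [eq_div_iff h1.ne', sub_zero, add_mul, div_mul_cancel₀ _ h1.ne']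
    simp only [normSq_apply, sub_re, sub_im, one_re, one_im]
    ring
  rw [h3]
  exact div_nonneg (by linarith) h1.le

theorem cauchyKernel_add_conj {w : ℂ} (hw : ‖w‖ < 1) (t : ℝ) :
    cauchyKernel w hw t + (starRingEnd ℂ) w * cexp (t * I) / (1 - (starRingEnd ℂ) w * cexp (t * I)) =
      diskPoisson w t := by
  have ha := norm_mul_cexp_neg w t
  have hconj : (starRingEnd ℂ) w * cexp (t * I) = (starRingEnd ℂ) (w * cexp (-(t * I))) := by
    rw [map_mul, ← exp_conj, map_neg, map_mul, conj_I, conj_ofReal, mul_neg, neg_neg]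
  rw [hconj, diskPoisson]
  change (1 - w * cexp (-(t * I)))⁻¹ + _ = _
  set a := w * cexp (-(t * I))
  have h1 := one_sub_ne_zero_of_norm_lt (ha.trans_lt hw)
  have h2 : (1 - a)⁻¹ = 1 + a / (1 - a) := by field_simp; ring
  have h3 : (starRingEnd ℂ) a / (1 - (starRingEnd ℂ) a) = (starRingEnd ℂ) (a / (1 - a)) := by
    rw [map_div₀, map_sub, map_one]
  rw [h2, h3, add_assoc, add_conj]
  push_cast
  ring

theorem integral_diskPoisson {w : ℂ} (hw : ‖w‖ < 1) (a b : ℝ) :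
    ∫ t in a..b, diskPoisson w t = b - a +
      2 * (log (1 - w * cexp (-(b * I))) - log (1 - w * cexp (-(a * I)))).im := by
  have hderiv : ∀ t : ℝ, HasDerivAt (fun t : ℝ => t + 2 * (log (1 - w * cexp (-(t * I)))).im)
      (diskPoisson w t) t := by
    intro t
    have h1 : HasDerivAt (fun t : ℝ => 1 - w * cexp (-(t * I)))
        (w * cexp (-(t * I)) * I) t := by
      have h2 : HasDerivAt (fun z : ℂ => 1 - w * cexp (-(z * I))) (w * cexp (-(t * I)) * I) (t : ℂ) :=
        ((((((hasDerivAt_id (t : ℂ)).mul_const I).neg).cexp).const_mul w).const_sub 1).congr_deriv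
          (by simp; ring)
      exact h2.comp_ofReal
    have h3 := h1.clog_real (Or.inl (re_one_sub_pos (by rwa [norm_mul_cexp_neg])))
    have h4 := imCLM.hasFDerivAt.comp_hasDerivAt t h3
    refine ((hasDerivAt_id t).add (h4.const_mul 2)).congr_deriv ?_
    rw [diskPoisson, imCLM_apply, mul_div_right_comm, mul_I_im]
  rw [intervalIntegral.integral_eq_sub_of_hasDerivAt (fun t _ => hderiv t)
    ((continuous_diskPoisson hw).intervalIntegrable _ _), sub_im]
  ring

theorem integral_diskPoisson_two_pi {w : ℂ} (hw : ‖w‖ < 1) :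
    ∫ t in 0..2 * π, diskPoisson w t = 2 * π := by
  have : cexp (-((2 * π : ℝ) * I)) = 1 := by
    push_cast
    rw [exp_neg, exp_two_pi_mul_I, inv_one]
  rw [integral_diskPoisson hw, this]
  simp

theorem integral_diskPoisson_stripToDisk {θ : ℝ} (hθ : θ ∈ Ioo (0 : ℝ) 1) {z : ℂ} (hz : z ∈ Sopen) :
    ∫ t in 0..2 * π * θ, diskPoisson (stripToDisk θ z) t = 2 * π * z.re := by
  have hw := norm_stripToDisk_lt_one hθ hz
  have hz' := Sopen_subset_closedStrip hz
  set w := stripToDisk θ z with hwdef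
  have hD := cexp_sub_ne_zero hθ hz'
  have h1 : 1 - w ≠ 0 := one_sub_ne_zero_of_norm_lt hw
  have hlt2 : ‖w * cexp (-((2 * π * θ : ℝ) * I))‖ < 1 := by rwa [norm_mul_cexp_neg]
  have h2 : 1 - w * cexp (-((2 * π * θ : ℝ) * I)) ≠ 0 := one_sub_ne_zero_of_norm_lt hlt2
  have hratio : 1 - w * cexp (-((2 * π * θ : ℝ) * I)) = cexp (π * I * z - π * θ * I) * (1 - w) := by
    have e1 : cexp (-((2 * π * θ : ℝ) * I)) = cexp (-(π * θ * I)) * cexp (-(π * θ * I)) := by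
      rw [← exp_add]
      congr 1
      push_cast
      ring
    have e2 : cexp (π * I * z - π * θ * I) = cexp (π * I * z) * cexp (-(π * θ * I)) := by
      rw [← exp_add, sub_eq_add_neg]
    have e3 : cexp (π * θ * I) * cexp (-(π * θ * I)) = 1 := by
      rw [← exp_add, add_neg_cancel, exp_zero]
    rw [hwdef, one_sub_stripToDisk hθ hz', e1, e2, stripToDisk]
    set A := cexp (π * I * z)
    set B := cexp (π * θ * I)
    set B' := cexp (-(π * θ * I))
    field_simp
    linear_combination (B' - A) * e3
  have harg : ∀ {a : ℂ}, ‖a‖ < 1 → |(log (1 - a)).im| < π / 2 := fun ha => by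
    rw [log_im]
    exact abs_arg_lt_pi_div_two_iff.2 (Or.inl (re_one_sub_pos ha))
  have hlog : log (1 - w * cexp (-((2 * π * θ : ℝ) * I))) - log (1 - w) =
      π * I * z - π * θ * I := by
    have b1 := abs_lt.1 (harg hlt2)
    have b2 := abs_lt.1 (harg hw)
    have him : (π * I * z - π * θ * I : ℂ).im = π * (z.re - θ) := by
      simp
      ring
    refine exp_inj_of_neg_pi_lt_of_le_pi ?_ ?_ ?_ ?_ ?_
    · rw [sub_im]; linarith [b1.1, b2.2]
    · rw [sub_im]; linarith [b1.2, b2.1]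
    · rw [him]; nlinarith [hz.1, hθ.2, Real.pi_pos]
    · rw [him]; nlinarith [hz.2, hθ.1, Real.pi_pos]
    · rw [exp_sub, exp_log h2, exp_log h1, div_eq_iff h1, hratio]
  rw [integral_diskPoisson hw, ofReal_zero, zero_mul, neg_zero, exp_zero, mul_one, hlog]
  simp
  ring

/-- The bilinear map `(k, b) ↦ k • b` from scalar functions and vectors to functions. -/
noncomputable def smulVec (X : Type*) [NormedAddCommGroup X] [NormedSpace ℂ X] :
    C(ℝ, ℂ) →ₗ[ℂ] X →ₗ[ℂ] C(ℝ, X) :=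
  LinearMap.mk₂ ℂ (fun k b => ⟨fun t => k t • b, by fun_prop⟩)
    (fun k k' b => by ext t; exact add_smul _ _ _)
    (fun c k b => by ext t; exact smul_assoc c (k t) b)
    (fun k b b' => by ext t; exact smul_add _ _ _)
    (fun c k b => by ext t; exact smul_comm (k t) c b)

theorem smulVec_apply (k : C(ℝ, ℂ)) (b : X) (t : ℝ) : smulVec X k b t = k t • b := rfl

theorem norm_apply_smulVec_le {θ : ℝ} {i0 : X0 →L[ℂ] E} {i1 : X1 →L[ℂ] E} {M : ℝ}
    {Λ : C(ℝ, interSub i0 i1) →ₗ[ℂ] ℂ}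
    (hΛ : ∀ u, ‖Λ u‖ ≤ M * arcMean θ fun t => (u t : X0 × X1)) (k : C(ℝ, ℂ))
    (b : interSub i0 i1) : ‖Λ (smulVec _ k b)‖ ≤ M * ((2 * π)⁻¹ *
      ((∫ t in 2 * π * θ..2 * π, ‖k t‖) * nzero i0 i1 b +
        (∫ t in 0..2 * π * θ, ‖k t‖) * none' i0 i1 b)) := by
  refine (hΛ _).trans_eq ?_
  simp only [arcMean, smulVec_apply, Submodule.coe_smul, Prod.smul_fst, Prod.smul_snd, norm_smul,
    intervalIntegral.integral_mul_const]
  rfl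

theorem norm_apply_smulVec_le_of_norm_le {θ : ℝ} (hθ : θ ∈ Ioo (0 : ℝ) 1) {i0 : X0 →L[ℂ] E}
    {i1 : X1 →L[ℂ] E} {M : ℝ} (hM : 0 ≤ M) {Λ : C(ℝ, interSub i0 i1) →ₗ[ℂ] ℂ}
    (hΛ : ∀ u, ‖Λ u‖ ≤ M * arcMean θ fun t => (u t : X0 × X1)) {k : C(ℝ, ℂ)} {K : ℝ}
    (hk : ∀ t, ‖k t‖ ≤ K) (b : interSub i0 i1) : ‖Λ (smulVec _ k b)‖ ≤
      M * (nzero i0 i1 b + none' i0 i1 b) * K := by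
  have hK : 0 ≤ K := (norm_nonneg _).trans (hk 0)
  have hintegr : ∀ a b : ℝ, 0 ≤ a → a ≤ b → b ≤ 2 * π →
      (2 * π)⁻¹ * ∫ t in a..b, ‖k t‖ ≤ K := by
    intro a b ha hab hb
    rw [inv_mul_le_iff₀ Real.two_pi_pos]
    calc ∫ t in a..b, ‖k t‖ ≤ ∫ t in a..b, K := intervalIntegral.integral_mono hab
          (k.continuous.norm.intervalIntegrable _ _) intervalIntegrable_const hk
      _ = (b - a) * K := by rw [intervalIntegral.integral_const, smul_eq_mul]
      _ ≤ 2 * π * K := by gcongr; linarith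
  have h2θ : 0 ≤ 2 * π * θ := by have := hθ.1; positivity
  have h2θ' : 2 * π * θ ≤ 2 * π := by nlinarith [hθ.2, Real.pi_pos]
  refine (norm_apply_smulVec_le hΛ k b).trans ?_
  rw [mul_assoc M]
  refine mul_le_mul_of_nonneg_left ?_ hM
  rw [mul_add, ← mul_assoc, ← mul_assoc, add_mul, mul_comm (nzero i0 i1 b),
    mul_comm (none' i0 i1 b)]
  exact add_le_add (mul_le_mul_of_nonneg_right (hintegr _ _ h2θ h2θ' le_rfl) (norm_nonneg _))
    (mul_le_mul_of_nonneg_right (hintegr _ _ le_rfl h2θ h2θ') (norm_nonneg _))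

open Classical in
/-- The analytic extension of a functional on continuous functions to the disk, by means of
the Cauchy kernel. -/
noncomputable def cauchyExtension (Λ : C(ℝ, X) →ₗ[ℂ] ℂ) (w : ℂ) : X →ₗ[ℂ] ℂ :=
  if hw : ‖w‖ < 1 then Λ ∘ₗ smulVec X (cauchyKernel w hw) else 0

theorem cauchyExtension_apply (Λ : C(ℝ, X) →ₗ[ℂ] ℂ) {w : ℂ} (hw : ‖w‖ < 1) (b : X) :
    cauchyExtension Λ w b = Λ (smulVec X (cauchyKernel w hw) b) := by
  rw [cauchyExtension, dif_pos hw, LinearMap.comp_apply]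

theorem differentiableOn_cauchyExtension {Λ : C(ℝ, X) →ₗ[ℂ] ℂ} {b : X} {D : ℝ}
    (hΛ : ∀ (k : C(ℝ, ℂ)) (K : ℝ), (∀ t, ‖k t‖ ≤ K) → ‖Λ (smulVec X k b)‖ ≤ D * K) :
    DifferentiableOn ℂ (fun w => cauchyExtension Λ w b) (Metric.ball 0 1) := by
  intro w₀ hw₀'
  have hw₀ : ‖w₀‖ < 1 := by simpa using hw₀'
  obtain ⟨r, hr₀, hr⟩ := exists_between hw₀
  set k' : C(ℝ, ℂ) := ⟨fun t : ℝ => cexp (-(t * I)) * cauchyKernel w₀ hw₀ t ^ 2, by fun_prop⟩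
  have hderiv : HasDerivAt (fun w => cauchyExtension Λ w b) (Λ (smulVec X k' b)) w₀ := by
    rw [hasDerivAt_iff_isLittleO]
    refine Asymptotics.IsBigO.trans_isLittleO (g := fun w => ‖w - w₀‖ ^ 2) ?_
      (Asymptotics.isLittleO_pow_sub_sub w₀ one_lt_two)
    refine Asymptotics.IsBigO.of_bound (D * (1 - r)⁻¹ ^ 3) ?_
    have hnhds : {w : ℂ | ‖w‖ < r} ∈ 𝓝 w₀ :=
      (isOpen_lt continuous_norm continuous_const).mem_nhds hr₀
    filter_upwards [hnhds] with w hwr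
    have hw : ‖w‖ < 1 := lt_trans hwr hr
    have hlin : cauchyExtension Λ w b - cauchyExtension Λ w₀ b - (w - w₀) • Λ (smulVec X k' b) =
        Λ (smulVec X (cauchyKernel w hw - cauchyKernel w₀ hw₀ - (w - w₀) • k') b) := by
      rw [cauchyExtension_apply Λ hw, cauchyExtension_apply Λ hw₀]
      simp only [map_sub, map_smul, LinearMap.sub_apply, LinearMap.smul_apply]
    rw [hlin, norm_pow, norm_norm, mul_assoc]
    refine hΛ _ _ fun t => ?_
    have h1 : 1 - w * cexp (-(t * I)) ≠ 0 :=
      one_sub_ne_zero_of_norm_lt (by rwa [norm_mul_cexp_neg])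
    have h2 : 1 - w₀ * cexp (-(t * I)) ≠ 0 :=
      one_sub_ne_zero_of_norm_lt (by rwa [norm_mul_cexp_neg])
    have heq : (cauchyKernel w hw - cauchyKernel w₀ hw₀ - (w - w₀) • k') t =
        (w - w₀) ^ 2 * cexp (-(t * I)) ^ 2 *
          (cauchyKernel w hw t * cauchyKernel w₀ hw₀ t ^ 2) := by
      change (1 - w * cexp (-(t * I)))⁻¹ - (1 - w₀ * cexp (-(t * I)))⁻¹ -
        (w - w₀) * (cexp (-(t * I)) * (1 - w₀ * cexp (-(t * I)))⁻¹ ^ 2) =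
        (w - w₀) ^ 2 * cexp (-(t * I)) ^ 2 *
          ((1 - w * cexp (-(t * I)))⁻¹ * (1 - w₀ * cexp (-(t * I)))⁻¹ ^ 2)
      generalize cexp (-(t * I)) = e at h1 h2
      have hA := mul_inv_cancel₀ h1
      have hB := mul_inv_cancel₀ h2
      generalize (1 - w * e)⁻¹ = A at hA ⊢
      generalize (1 - w₀ * e)⁻¹ = B at hB ⊢
      have hAB : A - B = (w - w₀) * e * (A * B) := by
        linear_combination B * hA - A * hB
      have hAB' : (w - w₀) * e * B * (A - B) = (w - w₀) * e * B * ((w - w₀) * e * (A * B)) := by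
        rw [hAB]
      linear_combination hAB + hAB'
    have hexp : ‖cexp (-(t * I))‖ = 1 := by
      rw [← neg_mul, ← ofReal_neg, norm_exp_ofReal_mul_I]
    rw [heq, norm_mul, norm_mul, norm_pow, norm_pow, hexp, one_pow, mul_one, norm_mul, norm_pow,
      mul_comm]
    refine mul_le_mul_of_nonneg_right ?_ (by positivity)
    calc ‖cauchyKernel w hw t‖ * ‖cauchyKernel w₀ hw₀ t‖ ^ 2 ≤ (1 - r)⁻¹ * (1 - r)⁻¹ ^ 2 := by
          have hA := norm_cauchyKernel_le hw hr hwr.le t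
          have hB := norm_cauchyKernel_le hw₀ hr hr₀.le t
          exact mul_le_mul hA (pow_le_pow_left₀ (norm_nonneg _) hB 2) (by positivity)
            ((norm_nonneg _).trans hA)
      _ = (1 - r)⁻¹ ^ 3 := by ring
  exact hderiv.differentiableAt.differentiableWithinAt

theorem cauchyExtension_zero {y : X →ₗ[ℂ] ℂ} {Λ : C(ℝ, X) →ₗ[ℂ] ℂ}
    (hΛ : ∀ (u : C(ℝ, X)) (q : ℂ → X), ContinuousOn q (Metric.closedBall 0 1) →
      DifferentiableOn ℂ q (Metric.ball 0 1) → (∀ t : ℝ, u t = q (cexp (t * I))) → Λ u = y (q 0)) :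
    cauchyExtension Λ 0 = y := by
  ext b
  rw [cauchyExtension_apply Λ (by simp)]
  refine hΛ _ (fun _ => b) continuousOn_const (differentiableOn_const _) fun t => ?_
  rw [smulVec_apply]
  change (1 - 0 * cexp (-(t * I)))⁻¹ • b = b
  simp

theorem cauchyExtension_eq_poisson {y : X →ₗ[ℂ] ℂ} {Λ : C(ℝ, X) →ₗ[ℂ] ℂ}
    (hΛ : ∀ (u : C(ℝ, X)) (q : ℂ → X), ContinuousOn q (Metric.closedBall 0 1) →
      DifferentiableOn ℂ q (Metric.ball 0 1) → (∀ t : ℝ, u t = q (cexp (t * I))) → Λ u = y (q 0))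
    {w : ℂ} (hw : ‖w‖ < 1) {P : C(ℝ, ℂ)} (hP : ∀ t, P t = diskPoisson w t) (b : X) :
    cauchyExtension Λ w b = Λ (smulVec X P b) := by
  rw [cauchyExtension_apply Λ hw, eq_comm, ← sub_eq_zero, ← map_sub, ← LinearMap.sub_apply,
    ← map_sub]
  set q : ℂ → ℂ := fun z => (starRingEnd ℂ) w * z / (1 - (starRingEnd ℂ) w * z) with hq
  have hqd : ∀ z ∈ Metric.closedBall (0 : ℂ) 1, DifferentiableAt ℂ (fun z => q z • b) z := by
    intro z hz
    have hz' : ‖(starRingEnd ℂ) w * z‖ < 1 := by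
      rw [norm_mul, norm_conj]
      exact (mul_le_of_le_one_right (norm_nonneg _) (by simpa using hz)).trans_lt hw
    have hd : DifferentiableAt ℂ (fun z => (starRingEnd ℂ) w * z) z :=
      differentiableAt_id.const_mul _
    exact (hd.div (hd.const_sub 1) (one_sub_ne_zero_of_norm_lt hz')).smul_const b
  rw [hΛ _ (fun z => q z • b) (fun z hz => (hqd z hz).continuousAt.continuousWithinAt)
    (fun z hz => (hqd z (Metric.ball_subset_closedBall hz)).differentiableWithinAt) fun t => ?_]
  · simp [hq]
  · rw [smulVec_apply, ContinuousMap.sub_apply, hP, ← cauchyKernel_add_conj hw, add_sub_cancel_left]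

theorem exists_extension {θ : ℝ} (hθ : θ ∈ Ioo (0 : ℝ) 1) [CompleteSpace X0] [CompleteSpace X1]
    {i0 : X0 →L[ℂ] E} {i1 : X1 →L[ℂ] E} {y : interSub i0 i1 →ₗ[ℂ] ℂ} {M : ℝ} (hM : 0 ≤ M)
    (hy : ∀ p : interSub i0 i1, interpNorm θ i0 i1 (i0 (p : X0 × X1).1) ≤ 1 → ‖y p‖ ≤ M) :
    ∃ h : ℂ → (interSub i0 i1 →ₗ[ℂ] ℂ), h θ = y ∧
      (∀ b, DifferentiableOn ℂ (fun z => h z b) Sopen) ∧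
      ∀ b, ∀ z ∈ Sopen, ‖h z b‖ ≤ M * nzero i0 i1 b ^ (1 - z.re) * none' i0 i1 b ^ z.re := by
  obtain ⟨Λ, hΛb, hΛ⟩ := exists_functional hθ hM hy
  have hmaps : MapsTo (stripToDisk θ) Sopen (Metric.ball 0 1) := fun z hz => by
    simpa using norm_stripToDisk_lt_one hθ hz
  have hd : ∀ b, DifferentiableOn ℂ (fun z => cauchyExtension Λ (stripToDisk θ z) b) Sopen :=
    fun b => (differentiableOn_cauchyExtension
      fun k K hk => norm_apply_smulVec_le_of_norm_le hθ hM hΛb hk b).comp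
      ((differentiableOn_stripToDisk hθ).mono Sopen_subset_closedStrip) hmaps
  refine ⟨fun z => cauchyExtension Λ (stripToDisk θ z), ?_, hd, fun b z hz => ?_⟩
  · simp only [stripToDisk_theta]
    exact cauchyExtension_zero hΛ
  have hn0 : 0 ≤ nzero i0 i1 b := norm_nonneg _
  have hn1 : 0 ≤ none' i0 i1 b := norm_nonneg _
  have hlin : ∀ z ∈ Sopen, ‖cauchyExtension Λ (stripToDisk θ z) b‖ ≤
      M * ((1 - z.re) * nzero i0 i1 b + z.re * none' i0 i1 b) := by
    intro z hz
    have hw := norm_stripToDisk_lt_one hθ hz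
    set P : C(ℝ, ℂ) := ⟨fun t => diskPoisson (stripToDisk θ z) t,
      continuous_ofReal.comp (continuous_diskPoisson hw)⟩ with hP
    rw [cauchyExtension_eq_poisson hΛ hw (P := P) (fun _ => rfl)]
    have hnorm : ∀ t, ‖P t‖ = diskPoisson (stripToDisk θ z) t := fun t => by
      rw [hP, ContinuousMap.coe_mk, norm_real, Real.norm_of_nonneg (diskPoisson_nonneg hw t)]
    refine (norm_apply_smulVec_le hΛb P b).trans_eq ?_
    have hc := continuous_diskPoisson hw
    have hI : ∫ t in 2 * π * θ..2 * π, diskPoisson (stripToDisk θ z) t =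
        2 * π - 2 * π * z.re := by
      have hadd := intervalIntegral.integral_add_adjacent_intervals
        (hc.intervalIntegrable 0 (2 * π * θ)) (hc.intervalIntegrable (2 * π * θ) (2 * π))
        (μ := volume)
      rw [integral_diskPoisson_stripToDisk hθ hz, integral_diskPoisson_two_pi hw] at hadd
      linarith
    simp only [hnorm]
    rw [hI, integral_diskPoisson_stripToDisk hθ hz]
    have := Real.pi_ne_zero
    field_simp
  have hb : ∀ z ∈ Sopen, ‖cauchyExtension Λ (stripToDisk θ z) b‖ ≤
      M * (nzero i0 i1 b + none' i0 i1 b) := fun z hz => by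
    refine (hlin z hz).trans (mul_le_mul_of_nonneg_left (add_le_add ?_ ?_) hM)
    · exact mul_le_of_le_one_left hn0 (by linarith [hz.1])
    · exact mul_le_of_le_one_left hn1 hz.2.le
  have hcont : Continuous fun x : ℝ => M * ((1 - x) * nzero i0 i1 b + x * none' i0 i1 b) := by
    fun_prop
  have h0 : Tendsto (fun x : ℝ => M * ((1 - x) * nzero i0 i1 b + x * none' i0 i1 b)) (𝓝[>] 0)
      (𝓝 (M * nzero i0 i1 b)) := by
    have := (hcont.tendsto 0).mono_left (nhdsWithin_le_nhds (s := Ioi 0))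
    simpa using this
  have h1 : Tendsto (fun x : ℝ => M * ((1 - x) * nzero i0 i1 b + x * none' i0 i1 b)) (𝓝[<] 1)
      (𝓝 (M * none' i0 i1 b)) := by
    have := (hcont.tendsto 1).mono_left (nhdsWithin_le_nhds (s := Iio 1))
    simpa using this
  refine (norm_le_interp_of_tendsto (hd b) hb hlin hlin h0 h1 hz).trans_eq ?_
  rw [Real.mul_rpow hM hn0, Real.mul_rpow hM hn1, mul_mul_mul_comm,
    ← Real.rpow_add' hM (by simp), sub_add_cancel, Real.rpow_one, mul_assoc]

theorem exists_calderonDiskFun (θ : ℝ) {i0 : X0 →L[ℂ] E} {i1 : X1 →L[ℂ] E}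
    (p : interSub i0 i1) : ∃ f : CalderonDiskFun θ i0 i1, f.toFun 0 = i0 (p : X0 × X1).1 := by
  set φ : ℂ → ℂ := fun z => (1 - z) * (1 - cexp (-((2 * π * θ : ℝ) * I)) * z) with hφ
  have hd : Differentiable ℂ fun z => φ z • p := by fun_prop
  refine ⟨CalderonDiskFun.ofInter (fun z => φ z • p) hd.continuous.continuousOn
    hd.differentiableOn (by simp [hφ]) ?_, ?_⟩
  · have : φ (cexp ((2 * π * θ : ℝ) * I)) = 0 := by
      rw [hφ]
      simp only [← exp_add, neg_add_cancel, exp_zero, sub_self, mul_zero]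
    simp only [this, zero_smul]
  · simp [CalderonDiskFun.ofInter, hφ]

theorem interpNorm_nonneg {θ : ℝ} (hθ : θ ∈ Ioo (0 : ℝ) 1) (i0 : X0 →L[ℂ] E) (i1 : X1 →L[ℂ] E)
    (x : E) : 0 ≤ interpNorm θ i0 i1 x := by
  refine Real.sInf_nonneg ?_
  rintro _ ⟨f, -, rfl⟩
  exact f.norm_nonneg hθ

theorem norm_apply_le_mul_interpNorm [CompleteSpace X0] [CompleteSpace X1] [CompleteSpace E]
    {θ : ℝ} (hθ : θ ∈ Ioo (0 : ℝ) 1)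
    {i0 : X0 →L[ℂ] E} {i1 : X1 →L[ℂ] E} {h : ℂ → (interSub i0 i1 →ₗ[ℂ] ℂ)} {C : ℝ} (hC : 0 ≤ C)
    (hbound : ∀ b : interSub i0 i1, ∀ z ∈ Sopen,
      ‖h z b‖ ≤ C * nzero i0 i1 b ^ (1 - z.re) * none' i0 i1 b ^ z.re)
    (hdiff : ∀ b : interSub i0 i1, DifferentiableOn ℂ (fun z => h z b) Sopen)
    (p : interSub i0 i1) : ‖h θ p‖ ≤ C * interpNorm θ i0 i1 (i0 (p : X0 × X1).1) := by
  obtain ⟨f, hf⟩ := exists_calderonDiskFun θ p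
  rcases hC.eq_or_lt with rfl | hC'
  · simpa using norm_apply_le_mul_norm hθ le_rfl hbound hdiff p f hf
  · rw [← div_le_iff₀' hC']
    refine le_csInf ⟨_, f, hf, rfl⟩ ?_
    rintro _ ⟨g, hg, rfl⟩
    rw [div_le_iff₀' hC']
    exact norm_apply_le_mul_norm hθ hC hbound hdiff p g hg

theorem memH_of_bound {i0 : X0 →L[ℂ] E} {i1 : X1 →L[ℂ] E} {h : ℂ → (interSub i0 i1 →ₗ[ℂ] ℂ)}
    {C : ℝ} (hC : 0 ≤ C) (hdiff : ∀ b, DifferentiableOn ℂ (fun z => h z b) Sopen)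
    (hbound : ∀ b, ∀ z ∈ Sopen,
      ‖h z b‖ ≤ C * nzero i0 i1 b ^ (1 - z.re) * none' i0 i1 b ^ z.re) : MemH i0 i1 h := by
  have hmax : ∀ b, ∀ z ∈ Sopen, ‖h z b‖ ≤ C * max (nzero i0 i1 b) (none' i0 i1 b) := by
    intro b z hz
    refine (hbound b z hz).trans ?_
    rw [mul_assoc]
    exact mul_le_mul_of_nonneg_left (rpow_one_sub_mul_rpow_le (norm_nonneg _) (norm_nonneg _)
      (le_max_left _ _) (le_max_right _ _) hz.1 hz.2) hC
  exact ⟨fun z hz => ⟨C, fun b => hmax b z hz⟩, fun b => ⟨hdiff b, _, hmax b⟩, C, hbound⟩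

theorem bddAbove_interpDual {θ : ℝ} (hθ : θ ∈ Ioo (0 : ℝ) 1)
    {i0 : X0 →L[ℂ] E} {i1 : X1 →L[ℂ] E} {y : interSub i0 i1 →ₗ[ℂ] ℂ} {C : ℝ}
    (hy : ∀ p : interSub i0 i1, ‖y p‖ ≤ C * interpNorm θ i0 i1 (i0 (p : X0 × X1).1)) :
    BddAbove {r | ∃ p : interSub i0 i1,
      interpNorm θ i0 i1 (i0 (p : X0 × X1).1) ≤ 1 ∧ r = ‖y p‖} := by
  refine ⟨|C|, ?_⟩
  rintro _ ⟨p, hp, rfl⟩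
  calc ‖y p‖ ≤ C * interpNorm θ i0 i1 (i0 (p : X0 × X1).1) := hy p
    _ ≤ |C| * interpNorm θ i0 i1 (i0 (p : X0 × X1).1) :=
        mul_le_mul_of_nonneg_right (le_abs_self C) (interpNorm_nonneg hθ i0 i1 _)
    _ ≤ |C| := mul_le_of_le_one_right (abs_nonneg C) hp

theorem interpDualNorm_nonneg (θ : ℝ) {i0 : X0 →L[ℂ] E} {i1 : X1 →L[ℂ] E}
    (y : interSub i0 i1 →ₗ[ℂ] ℂ) : 0 ≤ interpDualNorm θ i0 i1 y := by
  refine Real.sSup_nonneg ?_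
  rintro _ ⟨p, -, rfl⟩
  exact norm_nonneg _

theorem exists_memH_bound [CompleteSpace X0] [CompleteSpace X1] {θ : ℝ} (hθ : θ ∈ Ioo (0 : ℝ) 1)
    {i0 : X0 →L[ℂ] E} {i1 : X1 →L[ℂ] E} {y : interSub i0 i1 →ₗ[ℂ] ℂ} {C : ℝ}
    (hy : ∀ p : interSub i0 i1, ‖y p‖ ≤ C * interpNorm θ i0 i1 (i0 (p : X0 × X1).1)) :
    ∃ h, MemH i0 i1 h ∧ h ((θ : ℝ) : ℂ) = y ∧ HNorm i0 i1 h ≤ interpDualNorm θ i0 i1 y := by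
  have hM := interpDualNorm_nonneg θ y
  obtain ⟨h, hθy, hd, hb⟩ := exists_extension hθ hM
    fun p hp => le_csSup (bddAbove_interpDual hθ hy) ⟨p, hp, rfl⟩
  exact ⟨h, memH_of_bound hM hd hb, hθy, csInf_le ⟨0, fun _ hC => hC.1⟩ ⟨hM, hb⟩⟩

theorem MemH.exists_nonneg_bound {i0 : X0 →L[ℂ] E} {i1 : X1 →L[ℂ] E}
    {h : ℂ → (interSub i0 i1 →ₗ[ℂ] ℂ)} (hh : MemH i0 i1 h) :
    ∃ C : ℝ, 0 ≤ C ∧ ∀ b : interSub i0 i1, ∀ z ∈ Sopen,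
      ‖h z b‖ ≤ C * nzero i0 i1 b ^ (1 - z.re) * none' i0 i1 b ^ z.re := by
  obtain ⟨C, hC⟩ := hh.2.2
  refine ⟨max C 0, le_max_right _ _, fun b z hz => (hC b z hz).trans ?_⟩
  gcongr
  · exact Real.rpow_nonneg (norm_nonneg _) _
  · exact Real.rpow_nonneg (norm_nonneg _) _
  · exact le_max_left _ _

theorem MemH.interpDualNorm_le_HNorm [CompleteSpace X0] [CompleteSpace X1] [CompleteSpace E]
    {θ : ℝ} (hθ : θ ∈ Ioo (0 : ℝ) 1) {i0 : X0 →L[ℂ] E} {i1 : X1 →L[ℂ] E}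
    {h : ℂ → (interSub i0 i1 →ₗ[ℂ] ℂ)} (hh : MemH i0 i1 h) :
    interpDualNorm θ i0 i1 (h θ) ≤ HNorm i0 i1 h := by
  refine le_csInf ?_ fun C hC => csSup_le ⟨_, 0, ?_, rfl⟩ ?_
  · exact hh.exists_nonneg_bound
  · have := interpNorm_le_norm hθ (CalderonDiskFun.ofInter (fun _ => (0 : interSub i0 i1))
      continuousOn_const (differentiableOn_const _) rfl rfl)
    refine this.trans (max_le (Real.sSup_le ?_ zero_le_one) (Real.sSup_le ?_ zero_le_one)) <;>
    · rintro _ ⟨t, -, rfl⟩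
      simp [CalderonDiskFun.ofInter]
  · rintro _ ⟨p, hp, rfl⟩
    exact (norm_apply_le_mul_interpNorm hθ hC.1 hC.2 (fun b => (hh.2.1 b).1) p).trans
      (mul_le_of_le_one_right hC.1 hp)

end

/-- Calderón's duality theorem: for a regular Banach couple `(X₀, X₁)` and `θ ∈ (0,1)`,
the dual `([X₀,X₁]_θ)^#` coincides isometrically with `[X₀^#, X₁^#]^θ`: a functional
`y ∈ (X₀ ∩ X₁)^*` satisfies `sup {|⟨x,y⟩| : ‖x‖_{[X₀,X₁]_θ} ≤ 1} < ∞` iff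
`y ∈ [X₀^#, X₁^#]^θ`, and then the two norms agree. -/
theorem calderon_duality
    [CompleteSpace X0] [CompleteSpace X1] [CompleteSpace E]
    (θ : ℝ) (hθ : θ ∈ Ioo (0:ℝ) 1)
    (i0 : X0 →L[ℂ] E) (i1 : X1 →L[ℂ] E)
    (hi0 : Function.Injective i0) (hi1 : Function.Injective i1)
    (hreg0 : Dense {x : X0 | ∃ y : X1, i0 x = i1 y})
    (hreg1 : Dense {y : X1 | ∃ x : X0, i0 x = i1 y})
    (y : interSub i0 i1 →ₗ[ℂ] ℂ)
    (hy : ∃ C : ℝ, ∀ p : interSub i0 i1,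
      ‖y p‖ ≤ C * max (nzero i0 i1 p) (none' i0 i1 p)) :
    ((∃ C : ℝ, ∀ p : interSub i0 i1,
        ‖y p‖ ≤ C * interpNorm θ i0 i1 (i0 (p : X0 × X1).1)) ↔
      ∃ h, MemH i0 i1 h ∧ h ((θ:ℝ) : ℂ) = y) ∧
    ((∃ C : ℝ, ∀ p : interSub i0 i1,
        ‖y p‖ ≤ C * interpNorm θ i0 i1 (i0 (p : X0 × X1).1)) →
      interpDualNorm θ i0 i1 y = upperNorm θ i0 i1 y) := by
  refine ⟨⟨?_, ?_⟩, ?_⟩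
  · rintro ⟨C, hC⟩
    obtain ⟨h, hh, hhy, -⟩ := exists_memH_bound hθ hC
    exact ⟨h, hh, hhy⟩
  · rintro ⟨h, hh, rfl⟩
    obtain ⟨C, hC0, hC⟩ := hh.exists_nonneg_bound
    exact ⟨C, norm_apply_le_mul_interpNorm hθ hC0 hC fun b => (hh.2.1 b).1⟩
  · rintro ⟨C, hC⟩
    obtain ⟨h, hh, hhy, hle⟩ := exists_memH_bound hθ hC
    refine le_antisymm (le_csInf ⟨_, h, hh, hhy, rfl⟩ ?_) (le_trans (csInf_le ⟨0, ?_⟩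
      ⟨h, hh, hhy, rfl⟩) hle)
    · rintro _ ⟨g, hg, rfl, rfl⟩
      exact hg.interpDualNorm_le_HNorm hθ
    · rintro _ ⟨g, -, -, rfl⟩
      exact Real.sInf_nonneg fun _ hC => hC.1
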